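/- arXiv:2507.10254 — 3 statements merged into one kernel-verified Lean document; each statement's English description precedes it below -/
import Mathlib

section
/- Let Ω be a domain (nonempty connected open set) in ℝⁿ, (Y,d) a metric space, 1 ≤ q < ∞, K ≥ 0, and let φ : Ω → Y be a homeomorphism of Ω onto all of Y. Assume that for every Lipschitz function u : Y → ℝ the composition u∘φ is locally integrable on Ω and has a weak gradient v_u with (∫_Ω ‖v_u(x)‖^q dx)^{1/q} ≤ K·Lip(u). Then there exists a measurable function g : Ω → [0,∞) with ∫_Ω g^q dx < ∞ such that: (i) for every Lipschitz u : Y → ℝ, ‖v_u(x)‖ ≤ Lip(u)·g(x) for a.e. x ∈ Ω; (ii) for every open set U ⊆ Ω, ∫_U g(x)^q dx = Φ(φ(U)); in particular (∫_Ω g^q dx)^{1/q} equals the operator norm sup{ (∫_Ω ‖v_u‖^q dx)^{1/q} : u : Y → ℝ Lipschitz, Lip(u) ≤ 1 }. -/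
open MeasureTheory Set
open scoped ENNReal Topology NNReal

noncomputable section

/-- `f` has weak gradient `v` on the open set `Ω ⊆ ℝⁿ`. -/
def HasWeakGradOn {n : ℕ} (f : EuclideanSpace ℝ (Fin n) → ℝ)
    (v : EuclideanSpace ℝ (Fin n) → EuclideanSpace ℝ (Fin n))
    (Ω : Set (EuclideanSpace ℝ (Fin n))) : Prop :=
  LocallyIntegrableOn f Ω volume ∧ LocallyIntegrableOn v Ω volume ∧
    ∀ ψ : EuclideanSpace ℝ (Fin n) → ℝ, ContDiff ℝ (⊤ : ℕ∞) ψ → HasCompactSupport ψ →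
      tsupport ψ ⊆ Ω →
      ∫ x in Ω, f x • gradient ψ x = - ∫ x in Ω, ψ x • v x

/-- `u : Y → ℝ` is a Lipschitz function. -/
def IsLipschitz {Y : Type*} [MetricSpace Y] (u : Y → ℝ) : Prop :=
  ∃ L : ℝ, 0 ≤ L ∧ ∀ y₁ y₂, |u y₁ - u y₂| ≤ L * dist y₁ y₂

/-- the least Lipschitz constant of `u`. -/
def lipConst {Y : Type*} [MetricSpace Y] (u : Y → ℝ) : ℝ :=
  sInf {L : ℝ | 0 ≤ L ∧ ∀ y₁ y₂, |u y₁ - u y₂| ≤ L * dist y₁ y₂}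

/-- distance between two sets, `+∞` when one is empty. -/
def eSetDist {Y : Type*} [PseudoEMetricSpace Y] (A B : Set Y) : ℝ≥0∞ :=
  ⨅ y ∈ A, ⨅ z ∈ B, edist y z

/-- The set function `Φ` associated to the composition operator. -/
def Phi {n : ℕ} {Y : Type*} [MetricSpace Y] (q : ℝ)
    (φ : EuclideanSpace ℝ (Fin n) → Y) (Ω : Set (EuclideanSpace ℝ (Fin n)))
    (V : Set Y) : ℝ :=
  sSup {I : ℝ | ∃ (u : Y → ℝ) (v : EuclideanSpace ℝ (Fin n) → EuclideanSpace ℝ (Fin n)),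
    LipschitzWith 1 u ∧ 0 < eSetDist (tsupport u) Vᶜ ∧
    HasWeakGradOn (u ∘ φ) v Ω ∧ IntegrableOn (fun x => ‖v x‖ ^ q) Ω volume ∧
    I = ∫ x in Ω, ‖v x‖ ^ q}


lemma aux_integral_gradient {n : ℕ} (ψ : EuclideanSpace ℝ (Fin n) → ℝ)
    (hψ : ContDiff ℝ (⊤ : ℕ∞) ψ) (hc : HasCompactSupport ψ) :
    ∫ x, gradient ψ x = 0 := by
  have hgc : Continuous (gradient ψ) := by
    unfold gradient
    exact (LinearIsometryEquiv.continuous _).comp (hψ.continuous_fderiv (by simp))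
  have hgs : HasCompactSupport (gradient ψ) := by
    have := hc.fderiv (𝕜 := ℝ)
    unfold gradient
    exact this.comp_left (g := (InnerProductSpace.toDual ℝ (EuclideanSpace ℝ (Fin n))).symm)
      (map_zero _)
  have hgi : Integrable (gradient ψ) := hgc.integrable_of_hasCompactSupport hgs
  refine ext_inner_left ℝ fun w => ?_
  rw [← integral_inner hgi w, inner_zero_right]
  have h1 : ∀ x, inner ℝ w (gradient ψ x) = fderiv ℝ ψ x w := by
    intro x
    rw [real_inner_comm, gradient, InnerProductSpace.toDual_symm_apply]
  simp_rw [h1]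
  have h2 := integral_mul_fderiv_eq_neg_fderiv_mul_of_integrable (𝕜 := ℝ) (μ := volume)
    (f := fun _ : EuclideanSpace ℝ (Fin n) => (1:ℝ)) (g := ψ) (v := w) ?_ ?_ ?_ ?_ ?_
  · simpa using h2
  · simp
  · have := hgi.const_inner (𝕜 := ℝ) w
    simpa [h1] using this
  · simpa using hψ.continuous.integrable_of_hasCompactSupport hc
  · intro x _; fun_prop
  · intro x _; exact (hψ.differentiable (by simp)).differentiableAt

lemma aux_integrable_smul {n : ℕ} {F : Type*} [NormedAddCommGroup F] [NormedSpace ℝ F]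
    {f : EuclideanSpace ℝ (Fin n) → F}
    {Ω : Set (EuclideanSpace ℝ (Fin n))} (hf : LocallyIntegrableOn f Ω volume)
    {ψ : EuclideanSpace ℝ (Fin n) → ℝ} (hψ : Continuous ψ) (hc : HasCompactSupport ψ)
    (hs : tsupport ψ ⊆ Ω) : Integrable (fun x => ψ x • f x) := by
  have h1 : IntegrableOn f (tsupport ψ) := (hf.mono_set hs).integrableOn_isCompact hc
  have h2 : IntegrableOn (fun x => ψ x • f x) (tsupport ψ) :=
    h1.continuousOn_smul hψ.continuousOn hc
  rwa [integrableOn_iff_integrable_of_support_subset] at h2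
  intro x hx
  refine subset_tsupport _ ?_
  intro h0
  simp [h0] at hx

lemma aux_integrable_smul' {n : ℕ} {F : Type*} [NormedAddCommGroup F] [NormedSpace ℝ F]
    {f : EuclideanSpace ℝ (Fin n) → ℝ}
    {Ω : Set (EuclideanSpace ℝ (Fin n))} (hf : LocallyIntegrableOn f Ω volume)
    {ψ : EuclideanSpace ℝ (Fin n) → F} (hψ : Continuous ψ) (hc : HasCompactSupport ψ)
    (hs : tsupport ψ ⊆ Ω) : Integrable (fun x => f x • ψ x) := by
  have h1 : IntegrableOn f (tsupport ψ) := (hf.mono_set hs).integrableOn_isCompact hc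
  have h2 : IntegrableOn (fun x => f x • ψ x) (tsupport ψ) :=
    h1.smul_continuousOn hψ.continuousOn hc
  rwa [integrableOn_iff_integrable_of_support_subset] at h2
  intro x hx
  refine subset_tsupport _ ?_
  intro h0
  simp [h0] at hx

/-- locality of weak gradients -/
lemma aux_local {n : ℕ} {f f' : EuclideanSpace ℝ (Fin n) → ℝ}
    {v v' : EuclideanSpace ℝ (Fin n) → EuclideanSpace ℝ (Fin n)}
    {Ω O : Set (EuclideanSpace ℝ (Fin n))} (hO : IsOpen O) (hOΩ : O ⊆ Ω)
    (h : HasWeakGradOn f v Ω) (h' : HasWeakGradOn f' v' Ω) (s c : ℝ)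
    (hs : ∀ x ∈ O, f' x = s * f x + c) :
    ∀ᵐ x, x ∈ O → v' x = s • v x := by
  have hli : LocallyIntegrableOn (fun x => v' x - s • v x) O volume := by
    have h1 := h'.2.1.mono_set hOΩ
    have h2 := (h.2.1.mono_set hOΩ).smul s
    exact h1.sub h2
  have key := hO.ae_eq_zero_of_integral_contDiff_smul_eq_zero hli ?_
  · filter_upwards [key] with x hx hxO
    exact sub_eq_zero.1 (hx hxO)
  intro ψ hψ hc hsp
  have hsΩ : tsupport ψ ⊆ Ω := hsp.trans hOΩ
  have e1 := h.2.2 ψ hψ hc hsΩ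
  have e2 := h'.2.2 ψ hψ hc hsΩ
  have hgc : Continuous (gradient ψ) := by
    unfold gradient
    exact (LinearIsometryEquiv.continuous _).comp (hψ.continuous_fderiv (by simp))
  have hgs0 : tsupport (gradient ψ) ⊆ tsupport ψ := by
    refine subset_trans ?_ (tsupport_fderiv_subset ℝ (f := ψ))
    unfold gradient
    exact closure_mono (fun x hx => by
      intro h0
      apply hx
      simp [h0])
  have hgs : HasCompactSupport (gradient ψ) := hc.mono' (subset_closure.trans hgs0)
  have z1 : ∀ (F : EuclideanSpace ℝ (Fin n) → EuclideanSpace ℝ (Fin n)),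
      ∫ x in Ω, ψ x • F x = ∫ x, ψ x • F x := by
    intro F
    refine setIntegral_eq_integral_of_forall_compl_eq_zero fun x hx => ?_
    rw [image_eq_zero_of_notMem_tsupport (fun h => hx (hsΩ h)), zero_smul]
  have z2 : ∀ (F : EuclideanSpace ℝ (Fin n) → ℝ),
      ∫ x in Ω, F x • gradient ψ x = ∫ x, F x • gradient ψ x := by
    intro F
    refine setIntegral_eq_integral_of_forall_compl_eq_zero fun x hx => ?_
    rw [image_eq_zero_of_notMem_tsupport (fun h => hx (hsΩ (hgs0 h))), smul_zero]
  rw [z1, z2] at e1 e2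
  have i1 := aux_integrable_smul h.2.1 hψ.continuous hc hsΩ
  have i2 := aux_integrable_smul h'.2.1 hψ.continuous hc hsΩ
  have j1 := aux_integrable_smul' h.1 hgc hgs (hgs0.trans hsΩ)
  have a1 : ∫ x, ψ x • (v' x - s • v x) = (∫ x, ψ x • v' x) - s • ∫ x, ψ x • v x := by
    have i1s : Integrable (fun x => s • ψ x • v x) := i1.smul s
    rw [← integral_smul, ← integral_sub i2 i1s]
    congr 1; ext1 x
    rw [smul_sub, smul_comm]
  have a2 : ∫ x, f' x • gradient ψ x
      = s • (∫ x, f x • gradient ψ x) + c • ∫ x, gradient ψ x := by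
    have j1s : Integrable (fun x => s • f x • gradient ψ x) := j1.smul s
    have j2s : Integrable (fun x => c • gradient ψ x) :=
      (hgc.integrable_of_hasCompactSupport hgs).smul c
    rw [← integral_smul, ← integral_smul, ← integral_add j1s j2s]
    congr 1; ext1 x
    by_cases hx : x ∈ O
    · rw [hs x hx, add_smul, mul_smul]
    · rw [image_eq_zero_of_notMem_tsupport (f := gradient ψ) (fun h => hx (hsp (hgs0 h)))]
      simp
  rw [aux_integral_gradient ψ hψ hc, smul_zero, add_zero, e1, e2] at a2
  rw [a1, sub_eq_zero]
  have := congrArg Neg.neg a2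
  simpa using this

lemma aux_saw {α : Type*} [MeasurableSpace α] (μ : Measure α) [SFinite μ] (f : α → ℝ)
    (hf : AEMeasurable f μ) (ρ : ℝ) (hρ : 0 < ρ) :
    ∃ T : ℝ → ℝ, LipschitzWith 1 T ∧ (∀ t, 0 ≤ T t) ∧ (∀ t, T t ≤ ρ) ∧
      ∃ (J : ℤ × Bool → Set ℝ) (s c : ℤ × Bool → ℝ), (∀ i, IsOpen (J i)) ∧ (∀ i, |s i| = 1) ∧
        (∀ i, ∀ t ∈ J i, T t = s i * t + c i) ∧ ∀ᵐ x ∂μ, ∃ i, f x ∈ J i := by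
  have hC := Measure.countable_meas_level_set_pos₀ (μ := μ) (g := f) hf.nullMeasurable
  set C := {t | 0 < μ {a | f a = t}} with hCdef
  have hD : (⋃ m : ℤ, (fun t => t - m * ρ) '' C).Countable :=
    countable_iUnion fun m => hC.image _
  obtain ⟨a, ha⟩ : ∃ a, a ∉ ⋃ m : ℤ, (fun t => t - m * ρ) '' C := by
    by_contra hcon
    push Not at hcon
    exact Cardinal.not_countable_real (hD.mono fun x _ => hcon x)
  have hnull : ∀ m : ℤ, ∀ᵐ x ∂μ, f x ≠ a + m * ρ := by
    intro m
    rw [ae_iff]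
    simp only [ne_eq, not_not]
    by_contra hne
    apply ha
    refine mem_iUnion.2 ⟨m, a + m * ρ, pos_iff_ne_zero.2 hne, by ring⟩
  have h2 : (2 * ρ) ≠ 0 := by positivity
  have hT : ∀ t : ℝ, ‖((t - a : ℝ) : AddCircle (2 * ρ))‖
      = |(t - a) - round ((2 * ρ)⁻¹ * (t - a)) * (2 * ρ)| := fun t => AddCircle.norm_eq (2 * ρ)
  have hround : ∀ (t : ℝ) (m : ℤ), |t - a - m * (2 * ρ)| < ρ →
      round ((2 * ρ)⁻¹ * (t - a)) = m := by
    intro t m h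
    rw [round_eq, Int.floor_eq_iff]
    rw [abs_lt] at h
    have e : (2 * ρ)⁻¹ * (t - a) = (t - a - m * (2 * ρ)) / (2 * ρ) + m := by
      field_simp; ring
    have b1 : -(1/2) < (t - a - m * (2 * ρ)) / (2 * ρ) := by
      rw [lt_div_iff₀ (by positivity)]; linarith
    have b2 : (t - a - m * (2 * ρ)) / (2 * ρ) < 1/2 := by
      rw [div_lt_iff₀ (by positivity)]; linarith
    rw [e]; constructor <;> linarith
  refine ⟨fun t => ‖((t - a : ℝ) : AddCircle (2 * ρ))‖, ?_, fun t => norm_nonneg _, ?_,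
    fun i => if i.2 then Ioo (a + i.1 * (2 * ρ)) (a + i.1 * (2 * ρ) + ρ)
      else Ioo (a + i.1 * (2 * ρ) - ρ) (a + i.1 * (2 * ρ)),
    fun i => if i.2 then 1 else -1,
    fun i => if i.2 then -(a + i.1 * (2 * ρ)) else (a + i.1 * (2 * ρ)), ?_, ?_, ?_, ?_⟩
  · refine LipschitzWith.of_le_add fun x y => ?_
    have : ((x - a : ℝ) : AddCircle (2 * ρ)) = ((y - a : ℝ) : AddCircle (2 * ρ))
      + ((x - y : ℝ) : AddCircle (2 * ρ)) := by
      rw [← AddCircle.coe_add]; congr 1; ring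
    rw [this]
    refine (norm_add_le _ _).trans ?_
    gcongr
    rw [Real.dist_eq, ← Real.norm_eq_abs]
    exact QuotientAddGroup.norm_mk_le_norm
  · intro t
    refine (AddCircle.norm_le_half_period _ h2).trans ?_
    rw [abs_of_pos (by positivity)]; linarith
  · intro i; simp only; split_ifs <;> exact isOpen_Ioo
  · intro i; simp only; split_ifs <;> simp
  · rintro ⟨m, b⟩ t ht
    simp only at ht ⊢
    cases b
    · simp only [Bool.false_eq_true, ↓reduceIte, mem_Ioo] at ht ⊢
      rw [hT, hround t m (by rw [abs_lt]; constructor <;> linarith [ht.1, ht.2]),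
        abs_of_neg (by linarith [ht.2])]
      ring
    · simp only [↓reduceIte, mem_Ioo] at ht ⊢
      rw [hT, hround t m (by rw [abs_lt]; constructor <;> linarith [ht.1, ht.2]),
        abs_of_pos (by linarith [ht.1])]
      ring
  · filter_upwards [ae_all_iff.2 hnull] with x hx
    set k := ⌊(f x - a) / ρ⌋ with hk
    have k1 : (k : ℝ) ≤ (f x - a) / ρ := Int.floor_le _
    have k2 : (f x - a) / ρ < k + 1 := Int.lt_floor_add_one _
    rw [le_div_iff₀ hρ] at k1
    rw [div_lt_iff₀ hρ] at k2
    have k3 : (k : ℝ) * ρ < f x - a := lt_of_le_of_ne k1 (fun h => hx k (by linarith))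
    rcases Int.even_or_odd' k with ⟨m, hm | hm⟩
    · refine ⟨(m, true), ?_⟩
      have : (k : ℝ) = 2 * m := by rw [hm]; push_cast; ring
      rw [this] at k2 k3
      simp only [↓reduceIte, mem_Ioo]
      constructor <;> linarith
    · refine ⟨(m + 1, false), ?_⟩
      have : (k : ℝ) = 2 * m + 1 := by rw [hm]; push_cast; ring
      rw [this] at k2 k3
      simp only [Bool.false_eq_true, ↓reduceIte, mem_Ioo]
      push_cast
      constructor <;> linarith

lemma aux_cut {Y : Type*} [MetricSpace Y] {A W : Set Y} (hA : IsCompact A) (hW : IsOpen W)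
    (hAW : A ⊆ W) : ∃ (χ : Y → ℝ) (ρ : ℝ), LipschitzWith 1 χ ∧ 0 < ρ ∧ (∀ y, 0 ≤ χ y) ∧
      (∀ y ∈ A, ρ < χ y) ∧ ∀ y, 0 < χ y → ∀ z, z ∉ W → ρ ≤ dist y z := by
  by_cases hWu : W = univ
  · refine ⟨fun _ => 2, 1, LipschitzWith.const' 2, one_pos, fun _ => by norm_num,
      fun _ _ => by norm_num, fun y _ z hz => ?_⟩
    simp [hWu] at hz
  have hne : (Wᶜ).Nonempty := nonempty_compl.2 hWu
  obtain ⟨δ, hδ, hsub⟩ := hA.exists_thickening_subset_open hW hAW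
  refine ⟨fun y => max (Metric.infDist y Wᶜ - δ / 4) 0, δ / 4, ?_, by positivity,
    fun y => le_max_right _ _, ?_, ?_⟩
  · refine LipschitzWith.max_const ?_ 0
    refine LipschitzWith.of_le_add fun x y => ?_
    have := Metric.infDist_le_infDist_add_dist (s := Wᶜ) (x := x) (y := y)
    linarith
  · intro y hy
    refine lt_max_of_lt_left ?_
    have : δ ≤ Metric.infDist y Wᶜ := by
      rw [Metric.le_infDist hne]
      intro z hz
      by_contra hlt
      push Not at hlt
      exact hz (hsub (Metric.mem_thickening_iff.2 ⟨y, hy, by rwa [dist_comm]⟩))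
    linarith
  · intro y hy z hz
    have h1 : 0 < Metric.infDist y Wᶜ - δ / 4 := by
      by_contra h
      push Not at h
      simp [max_eq_right h] at hy
    have := Metric.infDist_le_dist_of_mem (s := Wᶜ) (x := y) hz
    linarith

lemma aux_glue_compact {n : ℕ} {Y : Type*} [MetricSpace Y]
    (Ω : Set (EuclideanSpace ℝ (Fin n))) (hΩo : IsOpen Ω)
    (φ : EuclideanSpace ℝ (Fin n) → Y)
    (hbij : Set.BijOn φ Ω Set.univ)
    (hcont : ContinuousOn φ Ω)
    (hopen : ∀ U : Set (EuclideanSpace ℝ (Fin n)), IsOpen U → U ⊆ Ω → IsOpen (φ '' U))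
    (hex : ∀ u : Y → ℝ, LipschitzWith 1 u → ∃ v, HasWeakGradOn (u ∘ φ) v Ω)
    (N : ℕ) (u : Fin (N + 1) → Y → ℝ) (hu : ∀ i, LipschitzWith 1 (u i))
    (v : Fin (N + 1) → EuclideanSpace ℝ (Fin n) → EuclideanSpace ℝ (Fin n))
    (hv : ∀ i, HasWeakGradOn (u i ∘ φ) (v i) Ω)
    (U : Set (EuclideanSpace ℝ (Fin n))) (hU : IsOpen U) (hUΩ : U ⊆ Ω)
    (A : Fin (N + 1) → Set (EuclideanSpace ℝ (Fin n))) (hA : ∀ i, IsCompact (A i))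
    (hAU : ∀ i, A i ⊆ U) (hdis : ∀ i j, i ≠ j → Disjoint (A i) (A j)) :
    ∃ w v', LipschitzWith 1 w ∧ 0 < eSetDist (tsupport w) (φ '' U)ᶜ ∧
      HasWeakGradOn (w ∘ φ) v' Ω ∧ ∀ i, ∀ᵐ x, x ∈ A i → ‖v' x‖ = ‖v i x‖ := by
  have hAΩ : ∀ i, A i ⊆ Ω := fun i => (hAU i).trans hUΩ
  have hKc : ∀ i, IsCompact (φ '' A i) := fun i => (hA i).image_of_continuousOn (hcont.mono (hAΩ i))
  have hKd : ∀ i j, i ≠ j → Disjoint (φ '' A i) (φ '' A j) := by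
    intro i j hij
    rw [Set.disjoint_left]
    rintro _ ⟨x, hx, rfl⟩ ⟨x', hx', he⟩
    have : x' = x := hbij.injOn (hAΩ j hx') (hAΩ i hx) he
    subst this
    exact Set.disjoint_left.1 (hdis i j hij) hx hx'
  let W : Fin (N + 1) → Set Y := fun i => φ '' U ∩ ⋂ j : {j // j ≠ i},
    {y | Metric.infEDist y (φ '' A i) < Metric.infEDist y (φ '' A j.1)}
  have hWo : ∀ i, IsOpen (W i) := fun i => (hopen U hU hUΩ).inter <| isOpen_iInter_of_finite
    fun j => isOpen_lt Metric.continuous_infEDist Metric.continuous_infEDist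
  have hKW : ∀ i, φ '' A i ⊆ W i := by
    intro i y hy
    refine ⟨image_mono (hAU i) hy, mem_iInter.2 fun j => ?_⟩
    show Metric.infEDist y (φ '' A i) < Metric.infEDist y (φ '' A j.1)
    rw [Metric.infEDist_zero_of_mem hy, pos_iff_ne_zero]
    intro h0
    rw [← Metric.mem_iff_infEDist_zero_of_closed (hKc j.1).isClosed] at h0
    exact Set.disjoint_left.1 (hKd i j.1 j.2.symm) hy h0
  have hWd : ∀ i j, i ≠ j → ∀ y ∈ W i, y ∉ W j := by
    intro i j hij y hy hy'
    have h1 : Metric.infEDist y (φ '' A i) < Metric.infEDist y (φ '' A j) :=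
      mem_iInter.1 hy.2 ⟨j, hij.symm⟩
    have h2 : Metric.infEDist y (φ '' A j) < Metric.infEDist y (φ '' A i) :=
      mem_iInter.1 hy'.2 ⟨i, hij⟩
    exact lt_asymm h1 h2
  choose χ ρ hχL hρ hχ0 hχA hχW using fun i => aux_cut (hKc i) (hWo i) (hKW i)
  have hχin : ∀ i y, 0 < χ i y → y ∈ W i := by
    intro i y hy
    by_contra hz
    have := hχW i y hy y hz
    rw [dist_self] at this
    exact absurd (hρ i) (not_lt.2 this)
  choose T hTL hT0 hTρ J s c hJo hs hJ hae using fun i =>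
    aux_saw (volume.restrict Ω) (u i ∘ φ) (hv i).1.aestronglyMeasurable.aemeasurable (ρ i) (hρ i)
  let t : Fin (N + 1) → Y → ℝ := fun i y => min (T i (u i y)) (χ i y)
  have htL : ∀ i, LipschitzWith 1 (t i) := by
    intro i
    have h1 : LipschitzWith 1 (fun y => T i (u i y)) := by
      have := (hTL i).comp (hu i)
      rwa [one_mul] at this
    have := h1.min (hχL i)
    simpa using this
  have ht0 : ∀ i y, 0 ≤ t i y := fun i y => le_min (hT0 i _) (hχ0 i y)
  let w : Y → ℝ := fun y => Finset.univ.sup' Finset.univ_nonempty fun i => t i y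
  have hwL : LipschitzWith 1 w := by
    refine LipschitzWith.of_le_add fun x y => ?_
    refine Finset.sup'_le _ _ fun i _ => ?_
    have h1 : t i x ≤ t i y + dist x y := by
      have := (htL i).dist_le_mul x y
      rw [Real.dist_eq] at this
      have := le_of_abs_le this
      simp at this
      linarith
    have h2 : t i y ≤ w y := Finset.le_sup' (fun i => t i y) (Finset.mem_univ i)
    linarith
  obtain ⟨v', hv'⟩ := hex w hwL
  refine ⟨w, v', hwL, ?_, hv', ?_⟩
  · obtain ⟨i0, hi0⟩ := Finite.exists_min ρ
    have hd : ∀ y ∈ tsupport w, ∀ z ∈ (φ '' U)ᶜ, ρ i0 ≤ dist y z := by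
      intro y hy z hz
      have hcl : IsClosed {y | ρ i0 ≤ dist y z} := isClosed_le continuous_const (by fun_prop)
      refine closure_minimal (s := Function.support w) ?_ hcl hy
      intro y hy
      obtain ⟨i, hi⟩ : ∃ i, 0 < χ i y := by
        by_contra hcon
        push Not at hcon
        apply hy
        have : ∀ i, t i y = 0 := fun i => le_antisymm ((min_le_right _ _).trans (hcon i)) (ht0 i y)
        show Finset.univ.sup' Finset.univ_nonempty (fun i => t i y) = 0
        simp [this]
      exact (hi0 i).trans (hχW i y hi z fun hzW => hz hzW.1)
    refine lt_of_lt_of_le (ENNReal.ofReal_pos.2 (hρ i0)) ?_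
    refine le_iInf₂ fun y hy => le_iInf₂ fun z hz => ?_
    rw [edist_dist]
    exact ENNReal.ofReal_le_ofReal (hd y hy z hz)
  · intro i
    let O : ℤ × Bool → Set (EuclideanSpace ℝ (Fin n)) := fun m =>
      Ω ∩ φ ⁻¹' ({y | ρ i < χ i y} ∩ u i ⁻¹' J i m)
    have hO : ∀ m, IsOpen (O m) := fun m => hcont.isOpen_inter_preimage hΩo
      ((isOpen_lt continuous_const (hχL i).continuous).inter
        ((hJo i m).preimage (hu i).continuous))
    have hloc : ∀ m, ∀ᵐ x, x ∈ O m → v' x = s i m • v i x := by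
      intro m
      refine aux_local (hO m) inter_subset_left (hv i) hv' (s i m) (c i m) ?_
      rintro x ⟨hxΩ, hx1, hx2⟩
      have hx1 : ρ i < χ i (φ x) := hx1
      show w (φ x) = s i m * u i (φ x) + c i m
      rw [← hJ i m _ hx2]
      have hti : t i (φ x) = T i (u i (φ x)) := min_eq_left ((hTρ i _).trans hx1.le)
      apply le_antisymm
      · refine Finset.sup'_le _ _ fun j _ => ?_
        by_cases hji : j = i
        · rw [hji, hti]
        · have hn : ¬ 0 < χ j (φ x) := fun h =>
            hWd i j (Ne.symm hji) _ (hχin i _ ((hρ i).trans hx1)) (hχin j _ h)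
          exact ((min_le_right _ _).trans (not_lt.1 hn)).trans (hT0 i _)
      · rw [← hti]
        exact Finset.le_sup' (fun i => t i (φ x)) (Finset.mem_univ i)
    have hae' := (ae_restrict_iff' hΩo.measurableSet).1 (hae i)
    filter_upwards [ae_all_iff.2 hloc, hae'] with x hx hx' hxA
    obtain ⟨m, hm⟩ := hx' (hAΩ i hxA)
    rw [hx m ⟨hAΩ i hxA, hχA i _ (mem_image_of_mem φ hxA), hm⟩, norm_smul, Real.norm_eq_abs,
      hs i m, one_mul]

lemma aux_glue {n : ℕ} {Y : Type*} [MetricSpace Y]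
    (Ω : Set (EuclideanSpace ℝ (Fin n))) (hΩo : IsOpen Ω) (q : ℝ)
    (φ : EuclideanSpace ℝ (Fin n) → Y)
    (hbij : Set.BijOn φ Ω Set.univ)
    (hcont : ContinuousOn φ Ω)
    (hopen : ∀ U : Set (EuclideanSpace ℝ (Fin n)), IsOpen U → U ⊆ Ω → IsOpen (φ '' U))
    (hex : ∀ u : Y → ℝ, LipschitzWith 1 u → ∃ v, HasWeakGradOn (u ∘ φ) v Ω)
    (N : ℕ) (u : Fin (N + 1) → Y → ℝ) (hu : ∀ i, LipschitzWith 1 (u i))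
    (v : Fin (N + 1) → EuclideanSpace ℝ (Fin n) → EuclideanSpace ℝ (Fin n))
    (hv : ∀ i, HasWeakGradOn (u i ∘ φ) (v i) Ω)
    (h : Fin (N + 1) → EuclideanSpace ℝ (Fin n) → ℝ≥0∞) (hm : ∀ i, Measurable (h i))
    (hh : ∀ i, ∀ᵐ x ∂(volume.restrict Ω), h i x = ‖v i x‖ₑ ^ q)
    (hfin : ∀ i, ∫⁻ x in Ω, h i x ≠ ⊤)
    (U : Set (EuclideanSpace ℝ (Fin n))) (hU : IsOpen U) (hUΩ : U ⊆ Ω)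
    (C : ℝ≥0∞)
    (hC : ∀ w v', LipschitzWith 1 w → 0 < eSetDist (tsupport w) (φ '' U)ᶜ →
      HasWeakGradOn (w ∘ φ) v' Ω → ∫⁻ x in Ω, ‖v' x‖ₑ ^ q ≤ C) :
    ∫⁻ x in U, ⨆ i, h i x ≤ C := by
  let M : Fin (N + 1) → Set (EuclideanSpace ℝ (Fin n)) := fun i => {x | ∀ j, h j x ≤ h i x}
  have hM : ∀ i, MeasurableSet (M i) := by
    intro i
    have : M i = ⋂ j, {x | h j x ≤ h i x} := by ext x; simp [M]
    rw [this]
    exact MeasurableSet.iInter fun j => measurableSet_le (hm j) (hm i)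
  let B : Fin (N + 1) → Set (EuclideanSpace ℝ (Fin n)) := fun i => U ∩ disjointed M i
  have hBm : ∀ i, MeasurableSet (B i) := fun i => hU.measurableSet.inter
    (disjointedRec (fun _ _ ht => MeasurableSet.diff ht <| hM _) (hM i))
  have hBU : ∀ i, B i ⊆ U := fun i => inter_subset_left
  have hBd : ∀ i j, i ≠ j → Disjoint (B i) (B j) := fun i j hij =>
    (disjoint_disjointed M hij).mono inter_subset_right inter_subset_right
  have hcov : U ⊆ ⋃ i, B i := by
    intro x hx
    have : x ∈ ⋃ i, disjointed M i := by
      rw [iUnion_disjointed]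
      obtain ⟨i, hi⟩ := Finite.exists_max (fun i => h i x)
      exact mem_iUnion.2 ⟨i, hi⟩
    obtain ⟨i, hi⟩ := mem_iUnion.1 this
    exact mem_iUnion.2 ⟨i, hx, hi⟩
  have step1 : ∫⁻ x in U, ⨆ i, h i x ≤ ∑' i, ∫⁻ x in B i, h i x := by
    refine (lintegral_mono_set hcov).trans ((lintegral_iUnion_le _ _).trans ?_)
    refine ENNReal.tsum_le_tsum fun i => ?_
    refine setLIntegral_mono (hm i) fun x hx => ?_
    exact iSup_le fun j => disjointed_subset M i hx.2 j
  refine step1.trans ?_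
  refine ENNReal.le_of_forall_pos_le_add fun ε hε _ => ?_
  obtain ⟨ε', hε', hsum⟩ := ENNReal.exists_pos_sum_of_countable
    (ENNReal.coe_ne_zero.2 hε.ne') (Fin (N + 1))
  have hcomp : ∀ i, ∃ A ⊆ B i, IsCompact A ∧
      ∫⁻ x in B i, h i x ≤ (∫⁻ x in A, h i x) + ε' i := by
    intro i
    let ν := (volume.restrict Ω).withDensity (h i)
    haveI : IsFiniteMeasure ν := isFiniteMeasure_withDensity (hfin i)
    have hν : ∀ S, MeasurableSet S → S ⊆ Ω → ν S = ∫⁻ x in S, h i x := by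
      intro S hS hSΩ
      rw [withDensity_apply _ hS, Measure.restrict_restrict hS, inter_eq_left.2 hSΩ]
    obtain ⟨A, hAB, hAc, hlt⟩ := (hBm i).exists_isCompact_lt_add (μ := ν) (measure_ne_top _ _)
      (ε := ε' i) (ENNReal.coe_ne_zero.2 (hε' i).ne')
    refine ⟨A, hAB, hAc, ?_⟩
    rw [← hν _ (hBm i) ((hBU i).trans hUΩ), ← hν _ hAc.measurableSet
      (hAB.trans ((hBU i).trans hUΩ))]
    exact hlt.le
  choose A hAB hAc hAle using hcomp
  have hAd : ∀ i j, i ≠ j → Disjoint (A i) (A j) := fun i j hij =>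
    (hBd i j hij).mono (hAB i) (hAB j)
  obtain ⟨w, v', hwL, hwd, hwg, hwv⟩ := aux_glue_compact Ω hΩo φ hbij hcont hopen hex N u hu v hv
    U hU hUΩ A hAc (fun i => (hAB i).trans (hBU i)) hAd
  have hAΩ : ∀ i, A i ⊆ Ω := fun i => (hAB i).trans ((hBU i).trans hUΩ)
  have hCw := hC w v' hwL hwd hwg
  have hsumA : ∑' i, ∫⁻ x in A i, h i x ≤ C := by
    have e : ∀ i, ∫⁻ x in A i, h i x = ∫⁻ x in A i, ‖v' x‖ₑ ^ q := by
      intro i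
      refine setLIntegral_congr_fun_ae (hAc i).measurableSet ?_
      filter_upwards [hwv i, (ae_restrict_iff' hΩo.measurableSet).1 (hh i)] with x h1 h2 hx
      rw [h2 (hAΩ i hx), ← ofReal_norm, ← ofReal_norm, h1 hx]
    simp_rw [e]
    rw [← lintegral_iUnion (fun i => (hAc i).measurableSet) (fun i j hij => hAd i j hij)]
    exact (lintegral_mono_set (iUnion_subset hAΩ)).trans hCw
  calc ∑' i, ∫⁻ x in B i, h i x ≤ ∑' i, ((∫⁻ x in A i, h i x) + ε' i) :=
        ENNReal.tsum_le_tsum hAle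
    _ = (∑' i, ∫⁻ x in A i, h i x) + ∑' i, (ε' i : ℝ≥0∞) := ENNReal.tsum_add
    _ ≤ C + ε := add_le_add hsumA hsum.le

lemma aux_mono_conv {α : Type*} [MeasurableSpace α] (μ : Measure α) (h : ℕ → α → ℝ≥0∞)
    (hm : ∀ i, Measurable (h i)) (C : ℝ≥0∞)
    (hC : ∀ N : ℕ, ∫⁻ x, ⨆ i : Fin (N + 1), h i x ∂μ ≤ C) :
    ∫⁻ x, ⨆ n, h n x ∂μ ≤ C := by
  have e : ∀ x, ⨆ n, h n x = ⨆ N : ℕ, ⨆ i : Fin (N + 1), h i x := by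
    intro x
    apply le_antisymm
    · exact iSup_le fun n => le_iSup_of_le n (le_iSup_of_le (Fin.last n) (by simp))
    · exact iSup_le fun N => iSup_le fun i => le_iSup (fun n => h n x) (i : ℕ)
  simp_rw [e]
  rw [lintegral_iSup (f := fun (N : ℕ) x => ⨆ i : Fin (N + 1), h i x)
    (fun N => Measurable.iSup fun i => hm i)]
  · exact iSup_le hC
  · intro N N' hN x
    refine iSup_le fun i => ?_
    exact le_iSup_of_le (⟨i, by omega⟩ : Fin (N' + 1)) le_rfl

lemma aux_esssup {α ι : Type*} [MeasurableSpace α] (μ : Measure α) [Nonempty ι]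
    (h : ι → α → ℝ≥0∞) (hm : ∀ i, Measurable (h i)) (C : ℝ≥0∞) (hCt : C ≠ ⊤)
    (hC : ∀ k : ℕ → ι, ∫⁻ x, ⨆ n, h (k n) x ∂μ ≤ C) :
    ∃ k : ℕ → ι, ∀ i, ∀ᵐ x ∂μ, h i x ≤ ⨆ n, h (k n) x := by
  let I : (ℕ → ι) → ℝ≥0∞ := fun k => ∫⁻ x, ⨆ n, h (k n) x ∂μ
  obtain ⟨a, -, ha, haI⟩ := exists_seq_tendsto_sSup (range_nonempty I) (OrderTop.bddAbove _)
  choose kk hkk using haI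
  let K : ℕ → ι := fun n => kk n.unpair.1 n.unpair.2
  have hK : sSup (range I) ≤ I K := by
    refine le_of_tendsto' ha fun m => ?_
    rw [← hkk m]
    refine lintegral_mono fun x => iSup_le fun n => ?_
    refine le_iSup_of_le (Nat.pair m n) ?_
    simp [K]
  refine ⟨K, fun i => ?_⟩
  let K' : ℕ → ι := fun n => Nat.casesOn n i K
  have hle : ∀ x, ⨆ n, h (K n) x ≤ ⨆ n, h (K' n) x := fun x =>
    iSup_le fun n => le_iSup (fun n => h (K' n) x) (n + 1)
  have hK' : I K' ≤ I K := (le_sSup (mem_range_self K')).trans hK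
  have := ae_eq_of_ae_le_of_lintegral_le (μ := μ) (Filter.Eventually.of_forall hle)
    (ne_top_of_le_ne_top hCt (hC K)) (Measurable.iSup fun n => hm _).aemeasurable hK'
  filter_upwards [this] with x hx
  rw [hx]
  exact le_iSup (fun n => h (K' n) x) 0

/-- A homeomorphism `φ : Ω → Y` inducing a bounded composition operator
`Lip(Y) → L¹_q(Ω)` belongs to the Reshetnyak class: there is a minimal upper gradient `g`
whose `L_q`-norm reproduces `Φ` on open sets and equals the operator norm. -/
theorem reshetnyak_class_of_bounded_composition
    {n : ℕ} (hn : 0 < n) {Y : Type*} [MetricSpace Y]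
    (Ω : Set (EuclideanSpace ℝ (Fin n))) (hΩo : IsOpen Ω) (hΩc : IsConnected Ω)
    (q K : ℝ) (hq : 1 ≤ q) (hK : 0 ≤ K)
    (φ : EuclideanSpace ℝ (Fin n) → Y)
    (hbij : Set.BijOn φ Ω Set.univ)
    (hcont : ContinuousOn φ Ω)
    (hopen : ∀ U : Set (EuclideanSpace ℝ (Fin n)), IsOpen U → U ⊆ Ω → IsOpen (φ '' U))
    (hbd : ∀ u : Y → ℝ, IsLipschitz u →
      ∃ v, HasWeakGradOn (u ∘ φ) v Ω ∧ IntegrableOn (fun x => ‖v x‖ ^ q) Ω volume ∧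
        (∫ x in Ω, ‖v x‖ ^ q) ^ (1/q) ≤ K * lipConst u) :
    ∃ g : EuclideanSpace ℝ (Fin n) → ℝ, Measurable g ∧ (∀ x, 0 ≤ g x) ∧
      IntegrableOn (fun x => g x ^ q) Ω volume ∧
      (∀ u : Y → ℝ, IsLipschitz u →
        ∀ v : EuclideanSpace ℝ (Fin n) → EuclideanSpace ℝ (Fin n),
          HasWeakGradOn (u ∘ φ) v Ω →
          ∀ᵐ x ∂(volume.restrict Ω), ‖v x‖ ≤ lipConst u * g x) ∧
      (∀ U : Set (EuclideanSpace ℝ (Fin n)), IsOpen U → U ⊆ Ω →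
        ∫ x in U, g x ^ q = Phi q φ Ω (φ '' U)) ∧
      (∫ x in Ω, g x ^ q) ^ (1/q) =
        sSup {r : ℝ | ∃ (u : Y → ℝ)
            (v : EuclideanSpace ℝ (Fin n) → EuclideanSpace ℝ (Fin n)),
          LipschitzWith 1 u ∧ HasWeakGradOn (u ∘ φ) v Ω ∧
          IntegrableOn (fun x => ‖v x‖ ^ q) Ω volume ∧
          r = (∫ x in Ω, ‖v x‖ ^ q) ^ (1/q)} := by
  classical
  have hq0 : 0 < q := lt_of_lt_of_le one_pos hq
  have hbdd : ∀ u : Y → ℝ, IsLipschitz u →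
      ∀ y₁ y₂, |u y₁ - u y₂| ≤ lipConst u * dist y₁ y₂ := by
    intro u hu y₁ y₂
    rcases eq_or_lt_of_le (dist_nonneg (x := y₁) (y := y₂)) with h0 | h0
    · have : y₁ = y₂ := dist_eq_zero.1 h0.symm
      simp [this]
    · rw [← div_le_iff₀ h0]
      obtain ⟨L, hL⟩ := hu
      refine le_csInf ⟨L, hL⟩ fun L' hL' => ?_
      rw [div_le_iff₀ h0]
      exact hL'.2 y₁ y₂
  have hlip0 : ∀ u : Y → ℝ, 0 ≤ lipConst u := fun u => Real.sInf_nonneg fun L hL => hL.1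
  have hmem1 : ∀ u : Y → ℝ, LipschitzWith 1 u →
      (1:ℝ) ∈ {L : ℝ | 0 ≤ L ∧ ∀ y₁ y₂, |u y₁ - u y₂| ≤ L * dist y₁ y₂} := by
    intro u hu
    refine ⟨zero_le_one, fun y₁ y₂ => ?_⟩
    have := hu.dist_le_mul y₁ y₂
    rwa [Real.dist_eq] at this
  have hisl : ∀ u : Y → ℝ, LipschitzWith 1 u → IsLipschitz u := fun u hu => ⟨1, hmem1 u hu⟩
  have hlip1 : ∀ u : Y → ℝ, LipschitzWith 1 u → lipConst u ≤ 1 := fun u hu =>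
    csInf_le ⟨0, fun L hL => hL.1⟩ (hmem1 u hu)
  have hexn : ∀ (a : EuclideanSpace ℝ (Fin n)), ‖a‖ₑ ^ q = ENNReal.ofReal (‖a‖ ^ q) := by
    intro a
    rw [← ofReal_norm, ENNReal.ofReal_rpow_of_nonneg (norm_nonneg _) hq0.le]
  -- data for 1-Lipschitz functions
  have hdata : ∀ u : Y → ℝ, LipschitzWith 1 u → ∀ v, HasWeakGradOn (u ∘ φ) v Ω →
      IntegrableOn (fun x => ‖v x‖ ^ q) Ω volume ∧ ∫ x in Ω, ‖v x‖ ^ q ≤ K ^ q := by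
    intro u hu v hv
    obtain ⟨v', hv', hi', hb'⟩ := hbd u (hisl u hu)
    have hvv := aux_local hΩo subset_rfl hv' hv 1 0 (fun x _ => by simp)
    have hae : (fun x => ‖v' x‖ ^ q) =ᵐ[volume.restrict Ω] (fun x => ‖v x‖ ^ q) := by
      rw [Filter.EventuallyEq, ae_restrict_iff' hΩo.measurableSet]
      filter_upwards [hvv] with x hx hxΩ
      rw [hx hxΩ, one_smul]
    refine ⟨hi'.congr hae, ?_⟩
    rw [← integral_congr_ae hae]
    have h0 : 0 ≤ ∫ x in Ω, ‖v' x‖ ^ q := integral_nonneg fun x => by positivity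
    have h1 : (∫ x in Ω, ‖v' x‖ ^ q) ^ (1/q) ≤ K :=
      hb'.trans (mul_le_of_le_one_right hK (hlip1 u hu))
    have h2 := Real.rpow_le_rpow (by positivity) h1 hq0.le
    rwa [← Real.rpow_mul h0, one_div, inv_mul_cancel₀ hq0.ne', Real.rpow_one] at h2
  have hlint : ∀ v : EuclideanSpace ℝ (Fin n) → EuclideanSpace ℝ (Fin n),
      IntegrableOn (fun x => ‖v x‖ ^ q) Ω volume →
      ∫⁻ x in Ω, ‖v x‖ₑ ^ q = ENNReal.ofReal (∫ x in Ω, ‖v x‖ ^ q) := by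
    intro v hv
    rw [ofReal_integral_eq_lintegral_ofReal hv (Filter.Eventually.of_forall fun x => by positivity)]
    simp_rw [hexn]
  have hex : ∀ u : Y → ℝ, LipschitzWith 1 u → ∃ v, HasWeakGradOn (u ∘ φ) v Ω := by
    intro u hu
    obtain ⟨v, hv, -⟩ := hbd u (hisl u hu)
    exact ⟨v, hv⟩
  let ι := {u : Y → ℝ // LipschitzWith 1 u}
  haveI : Nonempty ι := ⟨⟨fun _ => 0, LipschitzWith.const' 0⟩⟩
  choose v hv using fun u : ι => hex u.1 u.2
  have ham : ∀ u : ι, AEMeasurable (fun x => ‖v u x‖ₑ ^ q) (volume.restrict Ω) := fun u =>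
    (hv u).2.1.aestronglyMeasurable.enorm.pow_const q
  let h : ι → EuclideanSpace ℝ (Fin n) → ℝ≥0∞ := fun u => (ham u).mk _
  have hm : ∀ u, Measurable (h u) := fun u => (ham u).measurable_mk
  have hh : ∀ u, ∀ᵐ x ∂(volume.restrict Ω), h u x = ‖v u x‖ₑ ^ q := fun u => by
    filter_upwards [(ham u).ae_eq_mk] with x hx
    exact hx.symm
  have hfin : ∀ u, ∫⁻ x in Ω, h u x ≠ ⊤ := by
    intro u
    rw [lintegral_congr_ae (hh u), hlint _ (hdata u.1 u.2 _ (hv u)).1]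
    exact ENNReal.ofReal_ne_top
  -- gluing
  have hglue : ∀ (k : ℕ → ι) (U : Set (EuclideanSpace ℝ (Fin n))), IsOpen U → U ⊆ Ω →
      ∀ C : ℝ, (∀ w v', LipschitzWith 1 w → 0 < eSetDist (tsupport w) (φ '' U)ᶜ →
      HasWeakGradOn (w ∘ φ) v' Ω → ∫ x in Ω, ‖v' x‖ ^ q ≤ C) →
      ∫⁻ x in U, ⨆ n, h (k n) x ≤ ENNReal.ofReal C := by
    intro k U hU hUΩ C hC
    refine aux_mono_conv _ (fun n => h (k n)) (fun n => hm _) _ fun N => ?_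
    refine aux_glue Ω hΩo q φ hbij hcont hopen hex N (fun i => (k i).1) (fun i => (k i).2)
      (fun i => v (k i)) (fun i => hv _) (fun i => h (k i)) (fun i => hm _) (fun i => hh _)
      (fun i => hfin _) U hU hUΩ _ fun w v' hw hd hg => ?_
    rw [hlint v' (hdata w hw v' hg).1]
    exact ENNReal.ofReal_le_ofReal (hC w v' hw hd hg)
  have hall : ∀ k : ℕ → ι, ∫⁻ x in Ω, ⨆ n, h (k n) x ≤ ENNReal.ofReal (K ^ q) := fun k =>
    hglue k Ω hΩo subset_rfl _ fun w v' hw _ hg => (hdata w hw v' hg).2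
  obtain ⟨k, hk⟩ := aux_esssup (volume.restrict Ω) h hm _ ENNReal.ofReal_ne_top hall
  let G : EuclideanSpace ℝ (Fin n) → ℝ≥0∞ := fun x => ⨆ n, h (k n) x
  have hGm : Measurable G := Measurable.iSup fun n => hm _
  have hGfin : ∫⁻ x in Ω, G x ≠ ⊤ := ne_top_of_le_ne_top ENNReal.ofReal_ne_top (hall k)
  have hGlt : ∀ᵐ x ∂(volume.restrict Ω), G x < ⊤ := ae_lt_top hGm hGfin
  let g : EuclideanSpace ℝ (Fin n) → ℝ := fun x => (G x).toReal ^ (1/q)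
  have hg0 : ∀ x, 0 ≤ g x := fun x => Real.rpow_nonneg ENNReal.toReal_nonneg _
  have hgq : ∀ x, g x ^ q = (G x).toReal := by
    intro x
    show ((G x).toReal ^ (1/q)) ^ q = _
    rw [← Real.rpow_mul ENNReal.toReal_nonneg, one_div, inv_mul_cancel₀ hq0.ne', Real.rpow_one]
  have hgint : IntegrableOn (fun x => g x ^ q) Ω volume := by
    simp_rw [hgq]
    exact integrable_toReal_of_lintegral_ne_top hGm.aemeasurable hGfin
  have hP1 : ∀ u : Y → ℝ, LipschitzWith 1 u → ∀ v', HasWeakGradOn (u ∘ φ) v' Ω →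
      ∀ᵐ x ∂(volume.restrict Ω), ‖v' x‖ ≤ g x := by
    intro u hu v' hv'
    have hvv := (ae_restrict_iff' hΩo.measurableSet).2
      (aux_local hΩo subset_rfl (hv ⟨u, hu⟩) hv' 1 0 (fun x _ => by simp))
    filter_upwards [hvv, hh ⟨u, hu⟩, hk ⟨u, hu⟩, hGlt] with x h1 h2 h3 h4
    rw [h1, one_smul]
    rw [h2, hexn] at h3
    have h5 : ‖v ⟨u, hu⟩ x‖ ^ q ≤ (G x).toReal :=
      (ENNReal.ofReal_le_iff_le_toReal h4.ne).1 h3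
    rw [← hgq] at h5
    exact (Real.rpow_le_rpow_iff (norm_nonneg _) (hg0 x) hq0).1 h5
  have hP2 : ∀ U : Set (EuclideanSpace ℝ (Fin n)), IsOpen U → U ⊆ Ω →
      ∫ x in U, g x ^ q = Phi q φ Ω (φ '' U) := by
    intro U hU hUΩ
    have hgU : IntegrableOn (fun x => g x ^ q) U volume := hgint.mono_set hUΩ
    apply le_antisymm
    · have hPn : 0 ≤ Phi q φ Ω (φ '' U) := by
        refine Real.sSup_nonneg ?_
        rintro I ⟨u, v', -, -, -, -, rfl⟩
        exact integral_nonneg fun x => by positivity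
      have h1 := hglue k U hU hUΩ (Phi q φ Ω (φ '' U)) (by
        intro w v' hw hd hg
        refine le_csSup ⟨K ^ q, ?_⟩ ⟨w, v', hw, hd, hg, (hdata w hw v' hg).1, rfl⟩
        rintro I ⟨u, v', hu, -, hg', -, rfl⟩
        exact (hdata u hu v' hg').2)
      simp_rw [hgq]
      rw [integral_toReal hGm.aemeasurable (ae_mono (Measure.restrict_mono_set _ hUΩ) hGlt)]
      exact ENNReal.toReal_le_of_le_ofReal hPn h1
    · refine csSup_le ?_ ?_
      · obtain ⟨v0, hv0⟩ := hex (fun _ => 0) (LipschitzWith.const' 0)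
        refine ⟨_, fun _ => 0, v0, LipschitzWith.const' 0, ?_, hv0,
          (hdata _ (LipschitzWith.const' 0) _ hv0).1, rfl⟩
        have : tsupport (fun _ : Y => (0:ℝ)) = ∅ := tsupport_eq_empty_iff.2 rfl
        simp [eSetDist, this]
      · rintro I ⟨u, v', hu, hd, hg, hi, rfl⟩
        have hOo : IsOpen (Ω ∩ φ ⁻¹' (tsupport u)ᶜ) :=
          hcont.isOpen_inter_preimage hΩo (isClosed_tsupport u).isOpen_compl
        have hz := aux_local hOo inter_subset_left hg hg 0 0 (by
          rintro x ⟨-, hx⟩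
          show u (φ x) = _
          rw [image_eq_zero_of_notMem_tsupport hx]; simp)
        have hsub : ∀ x ∈ Ω, x ∉ U → x ∈ Ω ∩ φ ⁻¹' (tsupport u)ᶜ := by
          intro x hx hxU
          refine ⟨hx, fun hxs => ?_⟩
          have hxV : φ x ∈ (φ '' U)ᶜ := by
            rintro ⟨x', hx', he⟩
            exact hxU (hbij.injOn (hUΩ hx') hx he ▸ hx')
          have : eSetDist (tsupport u) (φ '' U)ᶜ ≤ edist (φ x) (φ x) :=
            (iInf₂_le (φ x) hxs).trans (iInf₂_le (φ x) hxV)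
          rw [edist_self] at this
          exact absurd hd (not_lt.2 this)
        have e : ∫ x in Ω, ‖v' x‖ ^ q = ∫ x in U, ‖v' x‖ ^ q := by
          refine setIntegral_eq_of_subset_of_ae_diff_eq_zero hΩo.measurableSet.nullMeasurableSet
            hUΩ ?_
          filter_upwards [hz] with x hx hxd
          rw [hx (hsub x hxd.1 hxd.2), zero_smul, norm_zero, Real.zero_rpow hq0.ne']
        rw [e]
        refine integral_mono_ae (hi.mono_set hUΩ) hgU ?_
        filter_upwards [ae_mono (Measure.restrict_mono_set _ hUΩ) (hP1 u hu v' hg)] with x hx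
        exact Real.rpow_le_rpow (norm_nonneg _) hx hq0.le
  refine ⟨g, (hGm.ennreal_toReal.pow_const _), hg0, hgint, ?_, hP2, ?_⟩
  · intro u hu v' hv'
    rcases eq_or_lt_of_le (hlip0 u) with hL | hL
    · have hz := aux_local hΩo subset_rfl hv' hv' 0 (u (φ hΩc.nonempty.some)) (by
        intro x _
        have := hbdd u hu (φ x) (φ hΩc.nonempty.some)
        rw [← hL, zero_mul] at this
        have := abs_eq_zero.1 (le_antisymm this (abs_nonneg _))
        simp only [Function.comp_apply]
        linarith)
      filter_upwards [(ae_restrict_iff' hΩo.measurableSet).2 hz] with x hx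
      rw [hx, ← hL]; simp
    · have huL : LipschitzWith 1 (fun y => (lipConst u)⁻¹ * u y) := by
        refine LipschitzWith.of_le_add fun x y => ?_
        have h1 := le_of_abs_le (hbdd u hu x y)
        have h2 : (lipConst u)⁻¹ * (u x - u y) ≤ (lipConst u)⁻¹ * (lipConst u * dist x y) := by
          gcongr
        rw [inv_mul_cancel_left₀ hL.ne'] at h2
        linarith
      obtain ⟨v1, hv1⟩ := hex _ huL
      have hvv := aux_local hΩo subset_rfl hv1 hv' (lipConst u) 0 (by
        intro x _
        simp only [Function.comp_apply]
        rw [mul_inv_cancel_left₀ hL.ne', add_zero])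
      filter_upwards [(ae_restrict_iff' hΩo.measurableSet).2 hvv, hP1 _ huL v1 hv1] with x h1 h2
      rw [h1, norm_smul, Real.norm_of_nonneg hL.le]
      gcongr
  · have hset : ∀ u v', LipschitzWith 1 u → HasWeakGradOn (u ∘ φ) v' Ω →
        (∫ x in Ω, ‖v' x‖ ^ q) ^ (1/q) ≤ (∫ x in Ω, g x ^ q) ^ (1/q) := by
      intro u v' hu hg
      refine Real.rpow_le_rpow (integral_nonneg fun x => by positivity) ?_ (by positivity)
      refine integral_mono_ae (hdata u hu v' hg).1 hgint ?_
      filter_upwards [hP1 u hu v' hg] with x hx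
      exact Real.rpow_le_rpow (norm_nonneg _) hx hq0.le
    apply le_antisymm
    · set S := sSup {r : ℝ | ∃ (u : Y → ℝ)
            (v : EuclideanSpace ℝ (Fin n) → EuclideanSpace ℝ (Fin n)),
          LipschitzWith 1 u ∧ HasWeakGradOn (u ∘ φ) v Ω ∧
          IntegrableOn (fun x => ‖v x‖ ^ q) Ω volume ∧
          r = (∫ x in Ω, ‖v x‖ ^ q) ^ (1/q)} with hS
      have hS0 : 0 ≤ S := by
        refine Real.sSup_nonneg ?_
        rintro r ⟨u, v', -, -, -, rfl⟩
        exact Real.rpow_nonneg (integral_nonneg fun x => by positivity) _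
      have hle : ∫ x in Ω, g x ^ q ≤ S ^ q := by
        rw [hP2 Ω hΩo subset_rfl]
        refine Real.sSup_le ?_ (by positivity)
        rintro I ⟨u, v', hu, -, hg, hi, rfl⟩
        have h0 : 0 ≤ ∫ x in Ω, ‖v' x‖ ^ q := integral_nonneg fun x => by positivity
        have h1 : (∫ x in Ω, ‖v' x‖ ^ q) ^ (1/q) ≤ S := by
          refine le_csSup ⟨(∫ x in Ω, g x ^ q) ^ (1/q), ?_⟩ ⟨u, v', hu, hg, hi, rfl⟩
          rintro r ⟨u', v'', hu', hg', -, rfl⟩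
          exact hset u' v'' hu' hg'
        have h2 := Real.rpow_le_rpow (by positivity) h1 hq0.le
        rwa [← Real.rpow_mul h0, one_div, inv_mul_cancel₀ hq0.ne', Real.rpow_one] at h2
      have h3 := Real.rpow_le_rpow
        (integral_nonneg fun x => Real.rpow_nonneg (hg0 x) q) hle (by positivity : 0 ≤ 1/q)
      rwa [← Real.rpow_mul hS0 q, mul_one_div_cancel hq0.ne', Real.rpow_one] at h3
    · refine Real.sSup_le ?_ (Real.rpow_nonneg
        (integral_nonneg fun x => Real.rpow_nonneg (hg0 x) q) _)
      rintro r ⟨u, v', hu, hg, -, rfl⟩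
      exact hset u v' hu hg
end
end

section
/- Let Ω ⊆ ℝⁿ be a domain, (Y,d) a metric space, φ : Ω → Y a mapping, V ⊆ Y an open set, A ≥ 0, and 1 ≤ q < ∞. Suppose that every 1-Lipschitz function u : Y → ℝ with dist(spt u, Y∖V) > 0 is such that u∘φ is locally integrable on Ω with weak gradient v_u whose norm is q-integrable, and ∫_{φ⁻¹(V)} ‖v_u(x)‖^q dx ≤ A (the set φ⁻¹(V) being Lebesgue measurable under these hypotheses). Then for every 1-Lipschitz function u : Y → ℝ such that u∘φ is locally integrable on Ω with weak gradient v_u whose norm is q-integrable, one also has ∫_{φ⁻¹(V)} ‖v_u(x)‖^q dx ≤ A. -/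
open MeasureTheory Set
open scoped ENNReal Topology NNReal

noncomputable section

open Filter in
lemma gdct {α : Type*} [MeasurableSpace α] {μ : Measure α} {g : ℕ → α → ℝ} {W : ℕ → α → ℝ}
    {g₀ W₀ : α → ℝ} {C : ℝ} (hC : ∀ k x, |g k x| ≤ C)
    (hgm : ∀ k, AEStronglyMeasurable (g k) μ)
    (hW : ∀ k, Integrable (W k) μ) (hW₀ : Integrable W₀ μ)
    (hb : ∀ k, ∫ x, |W k x| ∂μ ≤ ∫ x, |W₀ x| ∂μ)
    (hg : ∀ᵐ x ∂μ, Tendsto (fun k => g k x) atTop (𝓝 (g₀ x)))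
    (hWt : ∀ᵐ x ∂μ, Tendsto (fun k => W k x) atTop (𝓝 (W₀ x))) :
    Tendsto (fun k => ∫ x, g k x * W k x ∂μ) atTop (𝓝 (∫ x, g₀ x * W₀ x ∂μ)) := by
  have h1 : Tendsto (fun k => ∫ x, (|W₀ x| + |W k x - W₀ x| - |W k x|) ∂μ) atTop (𝓝 0) := by
    have : (0:ℝ) = ∫ x, (0:ℝ) ∂μ := by simp
    rw [this]
    refine tendsto_integral_of_dominated_convergence (fun x => 2 * |W₀ x|) ?_ ?_ ?_ ?_
    · intro k
      exact ((hW₀.abs.add ((hW k).sub hW₀).abs).sub (hW k).abs).aestronglyMeasurable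
    · exact hW₀.abs.const_mul 2
    · intro k
      refine Eventually.of_forall fun x => ?_
      rw [Real.norm_eq_abs, abs_le]
      have a1 := abs_sub_abs_le_abs_sub (W k x) (W₀ x)
      have a2 := abs_sub (W k x) (W₀ x)
      have a3 := abs_nonneg (W₀ x)
      constructor <;> linarith
    · filter_upwards [hWt] with x hx
      have := ((hx.sub_const (W₀ x)).abs.const_add (|W₀ x|)).sub hx.abs
      simpa using this
  have h2 : Tendsto (fun k => ∫ x, |W k x - W₀ x| ∂μ) atTop (𝓝 0) := by
    refine squeeze_zero (fun k => integral_nonneg fun x => abs_nonneg _) (fun k => ?_) h1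
    have e1 : ∫ x, (|W₀ x| + |W k x - W₀ x| - |W k x|) ∂μ
        = ∫ x, |W₀ x| ∂μ + ∫ x, |W k x - W₀ x| ∂μ - ∫ x, |W k x| ∂μ := by
      have j1 : Integrable (fun x => |W k x - W₀ x|) μ := ((hW k).sub hW₀).abs
      have j2 : Integrable (fun x => |W₀ x| + |W k x - W₀ x|) μ := hW₀.abs.add j1
      rw [integral_sub j2 (hW k).abs, integral_add hW₀.abs j1]
    rw [e1]
    linarith [hb k]
  have i1 : ∀ k, Integrable (fun x => g k x * (W k x - W₀ x)) μ := fun k =>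
    ((hW k).sub hW₀).bdd_mul (c := C) (hgm k) (Eventually.of_forall fun x => hC k x)
  have i2 : ∀ k, Integrable (fun x => g k x * W₀ x) μ := fun k =>
    hW₀.bdd_mul (c := C) (hgm k) (Eventually.of_forall fun x => hC k x)
  have h3 : Tendsto (fun k => ∫ x, g k x * (W k x - W₀ x) ∂μ) atTop (𝓝 0) := by
    have h2' := h2.const_mul C
    rw [mul_zero] at h2'
    refine squeeze_zero_norm (fun k => ?_) h2'
    rw [← integral_const_mul]
    refine (norm_integral_le_integral_norm _).trans ?_
    refine integral_mono (i1 k).norm ((((hW k).sub hW₀).abs).const_mul C) fun x => ?_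
    simp only [norm_mul, Real.norm_eq_abs]
    exact mul_le_mul_of_nonneg_right (hC k x) (abs_nonneg _)
  have h4 : Tendsto (fun k => ∫ x, g k x * W₀ x ∂μ) atTop (𝓝 (∫ x, g₀ x * W₀ x ∂μ)) := by
    refine tendsto_integral_of_dominated_convergence (fun x => C * |W₀ x|)
      (fun k => (i2 k).aestronglyMeasurable) (hW₀.abs.const_mul C) ?_ ?_
    · intro k
      refine Eventually.of_forall fun x => ?_
      simp only [norm_mul, Real.norm_eq_abs]
      exact mul_le_mul_of_nonneg_right (hC k x) (abs_nonneg _)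
    · filter_upwards [hg] with x hx using hx.mul_const _
  have h5 := h3.add h4
  rw [zero_add] at h5
  refine h5.congr fun k => ?_
  rw [← integral_add (i1 k) (i2 k)]
  congr 1; ext x; ring

section glob
open Filter ContinuousLinearMap
open scoped Convolution

variable {n : ℕ}

local notation "𝔼" => EuclideanSpace ℝ (Fin n)

lemma mollify_fderiv {H W : 𝔼 → ℝ} (hH : Integrable H) (e : 𝔼)
    (hw : ∀ ψ : 𝔼 → ℝ, ContDiff ℝ (⊤ : ℕ∞) ψ → HasCompactSupport ψ →
      ∫ x, H x * fderiv ℝ ψ x e = - ∫ x, ψ x * W x)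
    {η : 𝔼 → ℝ} (hη : ContDiff ℝ (⊤ : ℕ∞) η) (hηc : HasCompactSupport η) (x : 𝔼) :
    fderiv ℝ (η ⋆[lsmul ℝ ℝ, volume] H) x e = (η ⋆[lsmul ℝ ℝ, volume] W) x := by
  have hη1 : ContDiff ℝ 1 η := hη.of_le (by exact_mod_cast le_top)
  have h1 := (hηc.hasFDerivAt_convolution_left (lsmul ℝ ℝ) hη1 hH.locallyIntegrable x).fderiv
  rw [h1]
  have hex : ConvolutionExistsAt (fderiv ℝ η) H x ((lsmul ℝ ℝ : ℝ →L[ℝ] ℝ →L[ℝ] ℝ).precompL 𝔼)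
      volume :=
    (hηc.fderiv ℝ).convolutionExists_left _ (hη1.continuous_fderiv one_ne_zero)
      hH.locallyIntegrable x
  rw [convolution_def, ContinuousLinearMap.integral_apply hex, convolution_eq_swap]
  have h2 := hw (fun t => η (x - t)) (hη.comp (contDiff_const.sub contDiff_id))
    (hηc.comp_homeomorph (Homeomorph.subLeft x))
  have h3 : ∀ t, fderiv ℝ (fun t => η (x - t)) t e = - fderiv ℝ η (x - t) e := by
    intro t
    have hd : HasFDerivAt η (fderiv ℝ η (x - t)) (x - t) :=
      (hη1.differentiable one_ne_zero _).hasFDerivAt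
    have := hd.comp t ((hasFDerivAt_id t).const_sub x)
    have h' := this.fderiv
    simp only [Function.comp_def] at h'
    rw [h']
    simp
  simp only [h3] at h2
  rw [← integral_sub_left_eq_self _ _ x]
  simp only [sub_sub_cancel, precompL_apply, lsmul_apply, smul_eq_mul] at h2 ⊢
  simp only [mul_neg, integral_neg, neg_inj] at h2
  rw [← h2]
  congr 1; ext t; ring

lemma chain_global {H W : 𝔼 → ℝ} (hH : Integrable H) (hW : Integrable W) (e : 𝔼)
    (hw : ∀ ψ : 𝔼 → ℝ, ContDiff ℝ (⊤ : ℕ∞) ψ → HasCompactSupport ψ →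
      ∫ x, H x * fderiv ℝ ψ x e = - ∫ x, ψ x * W x)
    {F F' : ℝ → ℝ} (hF : ∀ t, HasDerivAt F (F' t) t) (hF'c : Continuous F') {C : ℝ}
    (hFC : ∀ t, |F t| ≤ C) (hFC' : ∀ t, |F' t| ≤ C)
    (ψ : 𝔼 → ℝ) (hψ : ContDiff ℝ (⊤ : ℕ∞) ψ) (hψc : HasCompactSupport ψ) :
    ∫ x, F (H x) * fderiv ℝ ψ x e = - ∫ x, (ψ x * F' (H x)) * W x := by
  let b : ℕ → ContDiffBump (0 : 𝔼) := fun k =>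
    ⟨1 / ((k:ℝ) + 1), 2 * (1 / ((k:ℝ) + 1)), by positivity, by
      have : 0 < 1 / ((k:ℝ) + 1) := by positivity
      linarith⟩
  have hb0 : Tendsto (fun k => (b k).rOut) atTop (𝓝 0) := by
    simpa [b] using (tendsto_one_div_add_atTop_nhds_zero_nat (𝕜 := ℝ)).const_mul 2
  have hbK : ∀ᶠ k in atTop, (b k).rOut ≤ 2 * (b k).rIn := Eventually.of_forall fun k => le_rfl
  let η : ℕ → 𝔼 → ℝ := fun k => (b k).normed volume
  have hη : ∀ k, ContDiff ℝ (⊤ : ℕ∞) (η k) := fun k => (b k).contDiff_normed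
  have hηc : ∀ k, HasCompactSupport (η k) := fun k => (b k).hasCompactSupport_normed
  have hηi : ∀ k, Integrable (η k) := fun k => (hη k).continuous.integrable_of_hasCompactSupport (hηc k)
  let Hk : ℕ → 𝔼 → ℝ := fun k => (η k) ⋆[lsmul ℝ ℝ, volume] H
  let Wk : ℕ → 𝔼 → ℝ := fun k => (η k) ⋆[lsmul ℝ ℝ, volume] W
  have hHt : ∀ᵐ x, Tendsto (fun k => Hk k x) atTop (𝓝 (H x)) :=
    ContDiffBump.ae_convolution_tendsto_right_of_locallyIntegrable hb0 hbK hH.locallyIntegrable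
  have hWt : ∀ᵐ x, Tendsto (fun k => Wk k x) atTop (𝓝 (W x)) :=
    ContDiffBump.ae_convolution_tendsto_right_of_locallyIntegrable hb0 hbK hW.locallyIntegrable
  have hHc : ∀ k, ContDiff ℝ (⊤ : ℕ∞) (Hk k) := fun k =>
    (hηc k).contDiff_convolution_left _ (hη k) hH.locallyIntegrable
  have hWc : ∀ k, Continuous (Wk k) := fun k =>
    (hηc k).continuous_convolution_left _ (hη k).continuous hW.locallyIntegrable
  have hWi : ∀ k, Integrable (Wk k) := fun k => (hηi k).integrable_convolution _ hW
  have hWb : ∀ k, ∫ x, |Wk k x| ≤ ∫ x, |W x| := by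
    intro k
    have e1 : ∫ x, ((η k) ⋆[lsmul ℝ ℝ, volume] (fun x => |W x|)) x = ∫ x, |W x| := by
      rw [integral_convolution (lsmul ℝ ℝ) (hηi k) hW.abs]
      have : ∫ x, η k x = 1 := (b k).integral_normed
      rw [this]; simp
    rw [← e1]
    refine integral_mono (hWi k).abs ((hηi k).integrable_convolution _ hW.abs) fun x => ?_
    show |∫ t, η k t * W (x - t)| ≤ ∫ t, η k t * |W (x - t)|
    refine (norm_integral_le_integral_norm (fun t => η k t * W (x - t))).trans (le_of_eq ?_)
    congr 1; ext t
    have : 0 ≤ η k t := (b k).nonneg_normed t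
    simp [abs_of_nonneg this]
  have hψ1 : ContDiff ℝ 1 ψ := hψ.of_le (by exact_mod_cast le_top)
  have hFd : ∀ k x, HasFDerivAt (fun x => F (Hk k x)) (F' (Hk k x) • fderiv ℝ (Hk k) x) x := by
    intro k x
    exact (hF _).comp_hasFDerivAt x (((hHc k).differentiable (by simp)) x).hasFDerivAt
  have hFcont : Continuous F := continuous_iff_continuousAt.2 fun t => (hF t).continuousAt
  have hFd' : ∀ k x, fderiv ℝ (fun x => F (Hk k x)) x e = F' (Hk k x) * Wk k x := by
    intro k x
    rw [(hFd k x).fderiv]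
    simp only [FunLike.coe_smul, Pi.smul_apply, smul_eq_mul]
    rw [mollify_fderiv hH e hw (hη k) (hηc k)]
  have hψe : Continuous fun x => fderiv ℝ ψ x e :=
    (hψ1.continuous_fderiv one_ne_zero).clm_apply continuous_const
  have hψec : HasCompactSupport fun x => fderiv ℝ ψ x e := hψc.fderiv_apply ℝ e
  have hk : ∀ k, ∫ x, F (Hk k x) * fderiv ℝ ψ x e = - ∫ x, (ψ x * F' (Hk k x)) * Wk k x := by
    intro k
    have hHkc := (hHc k).continuous
    have c1 : Continuous fun x => F' (Hk k x) * Wk k x := (hF'c.comp hHkc).mul (hWc k)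
    rw [integral_mul_fderiv_eq_neg_fderiv_mul_of_integrable]
    · congr 2; ext x; rw [hFd']; ring
    · simp only [hFd']
      exact (c1.mul hψ.continuous).integrable_of_hasCompactSupport hψc.mul_left
    · exact ((hFcont.comp hHkc).mul hψe).integrable_of_hasCompactSupport hψec.mul_left
    · exact ((hFcont.comp hHkc).mul hψ.continuous).integrable_of_hasCompactSupport hψc.mul_left
    · exact fun x _ => (hFd k x).differentiableAt
    · exact fun x _ => hψ1.differentiable one_ne_zero x
  have l1 : Tendsto (fun k => ∫ x, F (Hk k x) * fderiv ℝ ψ x e) atTop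
      (𝓝 (∫ x, F (H x) * fderiv ℝ ψ x e)) := by
    refine tendsto_integral_of_dominated_convergence (fun x => C * |fderiv ℝ ψ x e|) ?_ ?_ ?_ ?_
    · exact fun k => ((hFcont.comp (hHc k).continuous).mul hψe).aestronglyMeasurable
    · exact (hψe.integrable_of_hasCompactSupport hψec).abs.const_mul C
    · intro k
      refine Eventually.of_forall fun x => ?_
      simp only [norm_mul, Real.norm_eq_abs]
      exact mul_le_mul_of_nonneg_right (hFC _) (abs_nonneg _)
    · filter_upwards [hHt] with x hx
      exact ((hFcont.tendsto _).comp hx).mul_const _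
  obtain ⟨D, hD⟩ := hψc.exists_bound_of_continuous hψ.continuous
  have l2 : Tendsto (fun k => ∫ x, (ψ x * F' (Hk k x)) * Wk k x) atTop
      (𝓝 (∫ x, (ψ x * F' (H x)) * W x)) := by
    refine gdct (C := D * C) ?_ ?_ hWi hW hWb ?_ hWt
    · intro k x
      rw [abs_mul]
      exact mul_le_mul (hD x) (hFC' _) (abs_nonneg _) ((norm_nonneg _).trans (hD x))
    · exact fun k => (hψ.continuous.mul (hF'c.comp (hHc k).continuous)).aestronglyMeasurable
    · filter_upwards [hHt] with x hx
      exact ((hF'c.tendsto _).comp hx).const_mul _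
  simp only [hk] at l1
  exact tendsto_nhds_unique l1 l2.neg

lemma zero_global {H W : 𝔼 → ℝ} (hH : Integrable H) (hW : Integrable W) (e : 𝔼)
    (hw : ∀ ψ : 𝔼 → ℝ, ContDiff ℝ (⊤ : ℕ∞) ψ → HasCompactSupport ψ →
      ∫ x, H x * fderiv ℝ ψ x e = - ∫ x, ψ x * W x) :
    ∀ᵐ x, H x = 0 → W x = 0 := by
  classical
  have key : ∀ (ψ : 𝔼 → ℝ), ContDiff ℝ (⊤ : ℕ∞) ψ → HasCompactSupport ψ →
      ∫ x, ψ x • (({0} : Set ℝ).indicator (fun _ => (1:ℝ)) (H x) * W x) = 0 := by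
    intro ψ hψ hψc
    obtain ⟨D, hD⟩ := hψc.exists_bound_of_continuous hψ.continuous
    have hψ1 : ContDiff ℝ 1 ψ := hψ.of_le (by exact_mod_cast le_top)
    have hψe : Continuous fun x => fderiv ℝ ψ x e :=
      (hψ1.continuous_fderiv one_ne_zero).clm_apply continuous_const
    have hψec : HasCompactSupport fun x => fderiv ℝ ψ x e := hψc.fderiv_apply ℝ e
    have hch : ∀ k : ℕ, ∫ x, Real.arctan (((k:ℝ) + 1) * H x) / ((k:ℝ) + 1) * fderiv ℝ ψ x e
        = - ∫ x, (ψ x * (1 / (1 + (((k:ℝ) + 1) * H x) ^ 2))) * W x := by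
      intro k
      have hk : (0:ℝ) < (k:ℝ) + 1 := by positivity
      refine chain_global hH hW e hw (F := fun t => Real.arctan (((k:ℝ) + 1) * t) / ((k:ℝ) + 1))
        (F' := fun t => 1 / (1 + (((k:ℝ) + 1) * t) ^ 2)) (C := 2) ?_ ?_ ?_ ?_ ψ hψ hψc
      · intro t
        have := (((hasDerivAt_id t).const_mul ((k:ℝ) + 1)).arctan).div_const ((k:ℝ) + 1)
        rw [mul_one, mul_div_assoc, div_self hk.ne', mul_one] at this
        exact this
      · refine continuous_const.div (by fun_prop) fun t => by positivity
      · intro t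
        rw [abs_div, abs_of_pos hk]
        have h2 : |Real.arctan (((k:ℝ) + 1) * t)| ≤ 2 := by
          rw [abs_le]
          constructor <;> linarith [Real.pi_lt_d2, Real.neg_pi_div_two_lt_arctan (((k:ℝ) + 1) * t),
            Real.arctan_lt_pi_div_two (((k:ℝ) + 1) * t)]
        refine (div_le_self (abs_nonneg _) ?_).trans h2
        have : (0:ℝ) ≤ k := by positivity
        linarith
      · intro t
        rw [abs_of_nonneg (by positivity)]
        rw [div_le_iff₀ (by positivity)]
        nlinarith [sq_nonneg (((k:ℝ) + 1) * t)]
    have l1 : Tendsto (fun k : ℕ => ∫ x, Real.arctan (((k:ℝ) + 1) * H x) / ((k:ℝ) + 1)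
        * fderiv ℝ ψ x e) atTop (𝓝 0) := by
      have h0 := (tendsto_one_div_add_atTop_nhds_zero_nat (𝕜 := ℝ)).mul_const
        (2 * ∫ x, |fderiv ℝ ψ x e|)
      rw [zero_mul] at h0
      refine squeeze_zero_norm (fun k => ?_) h0
      have hk : (0:ℝ) < (k:ℝ) + 1 := by positivity
      rw [← integral_const_mul, ← integral_const_mul]
      refine norm_integral_le_of_norm_le
        (((hψe.integrable_of_hasCompactSupport hψec).abs.const_mul 2).const_mul _) ?_
      refine Eventually.of_forall fun x => ?_
      have h2 : |Real.arctan (((k:ℝ) + 1) * H x)| ≤ 2 := by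
        rw [abs_le]
        constructor <;> linarith [Real.pi_lt_d2, Real.neg_pi_div_two_lt_arctan (((k:ℝ) + 1) * H x),
          Real.arctan_lt_pi_div_two (((k:ℝ) + 1) * H x)]
      rw [norm_mul, Real.norm_eq_abs, Real.norm_eq_abs, abs_div, abs_of_pos hk, ← mul_assoc]
      refine mul_le_mul_of_nonneg_right ?_ (abs_nonneg _)
      rw [one_div_mul_eq_div]
      gcongr
    have l2 : Tendsto (fun k : ℕ => ∫ x, (ψ x * (1 / (1 + (((k:ℝ) + 1) * H x) ^ 2))) * W x) atTop
        (𝓝 (∫ x, ψ x • (({0} : Set ℝ).indicator (fun _ => (1:ℝ)) (H x) * W x))) := by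
      refine tendsto_integral_of_dominated_convergence (fun x => D * |W x|) ?_ ?_ ?_ ?_
      · intro k
        have hc : Continuous fun t : ℝ => 1 / (1 + (((k:ℝ) + 1) * t) ^ 2) :=
          continuous_const.div (by fun_prop) fun t => by positivity
        exact (hψ.continuous.aestronglyMeasurable.mul
          (hc.comp_aestronglyMeasurable hH.aestronglyMeasurable)).mul hW.aestronglyMeasurable
      · exact hW.abs.const_mul D
      · intro k
        refine Eventually.of_forall fun x => ?_
        rw [norm_mul, norm_mul, Real.norm_eq_abs (W x)]
        refine mul_le_mul_of_nonneg_right ?_ (abs_nonneg _)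
        refine (mul_le_of_le_one_right (norm_nonneg _) ?_).trans (hD x)
        rw [Real.norm_eq_abs, abs_of_nonneg (by positivity), div_le_one (by positivity)]
        nlinarith [sq_nonneg (((k:ℝ) + 1) * H x)]
      · refine Eventually.of_forall fun x => ?_
        simp only [smul_eq_mul, ← mul_assoc]
        refine Tendsto.mul_const _ (Tendsto.const_mul _ ?_)
        by_cases hx : H x = 0
        · simp [hx]
        · simp only [mem_singleton_iff, hx, not_false_eq_true, indicator_of_notMem]
          simp only [one_div]
          apply Tendsto.inv_tendsto_atTop
          apply tendsto_atTop_add_const_left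
          simp only [mul_pow]
          apply Tendsto.atTop_mul_const (by positivity)
          exact (tendsto_pow_atTop two_ne_zero).comp
            (tendsto_atTop_add_const_right _ _ tendsto_natCast_atTop_atTop)
    simp only [hch] at l1
    have := tendsto_nhds_unique l1 l2.neg
    linarith
  have hi : Integrable fun x => ({0} : Set ℝ).indicator (fun _ => (1:ℝ)) (H x) * W x := by
    refine hW.bdd_mul (c := 1) ?_ (Eventually.of_forall fun x => ?_)
    · have hm : Measurable (({0} : Set ℝ).indicator (fun _ => (1:ℝ))) :=
        measurable_const.indicator (measurableSet_singleton 0)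
      exact (hm.comp_aemeasurable hH.aestronglyMeasurable.aemeasurable).aestronglyMeasurable
    · by_cases hx : H x = 0 <;> simp [hx]
  filter_upwards [ae_eq_zero_of_integral_contDiff_smul_eq_zero hi.locallyIntegrable key] with x hx h0
  simpa [h0] using hx

end glob

section loc
open Filter ContinuousLinearMap

variable {n : ℕ}

local notation "𝔼" => EuclideanSpace ℝ (Fin n)

lemma int_aux_r {G : Type*} [NormedAddCommGroup G] [NormedSpace ℝ G] {Ω : Set 𝔼} {f : 𝔼 → ℝ}
    (hf : LocallyIntegrableOn f Ω) {g : 𝔼 → G} (hg : Continuous g) (hgc : HasCompactSupport g)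
    (hgs : tsupport g ⊆ Ω) : Integrable (fun x => f x • g x) := by
  have h1 : IntegrableOn f (tsupport g) := hf.integrableOn_compact_subset hgs hgc
  have h2 : Integrable ((tsupport g).indicator f) :=
    h1.integrable_indicator (isClosed_tsupport g).measurableSet
  refine (h2.locallyIntegrable.integrable_smul_right_of_hasCompactSupport hg hgc).congr
    (Eventually.of_forall fun x => ?_)
  by_cases hx : x ∈ tsupport g
  · simp [hx]
  · simp [image_eq_zero_of_notMem_tsupport hx]

lemma int_aux_l {G : Type*} [NormedAddCommGroup G] [NormedSpace ℝ G] {Ω : Set 𝔼} {f : 𝔼 → G}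
    (hf : LocallyIntegrableOn f Ω) {g : 𝔼 → ℝ} (hg : Continuous g) (hgc : HasCompactSupport g)
    (hgs : tsupport g ⊆ Ω) : Integrable (fun x => g x • f x) := by
  have h1 : IntegrableOn f (tsupport g) := hf.integrableOn_compact_subset hgs hgc
  have h2 : Integrable ((tsupport g).indicator f) :=
    h1.integrable_indicator (isClosed_tsupport g).measurableSet
  refine (h2.locallyIntegrable.integrable_smul_left_of_hasCompactSupport hg hgc).congr
    (Eventually.of_forall fun x => ?_)
  by_cases hx : x ∈ tsupport g
  · simp [hx]
  · simp [image_eq_zero_of_notMem_tsupport hx]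

/-- scalar directional weak derivative -/
def SW (f w : 𝔼 → ℝ) (e : 𝔼) (Ω : Set 𝔼) : Prop :=
  LocallyIntegrableOn f Ω volume ∧ LocallyIntegrableOn w Ω volume ∧
    ∀ ψ : 𝔼 → ℝ, ContDiff ℝ (⊤ : ℕ∞) ψ → HasCompactSupport ψ → tsupport ψ ⊆ Ω →
      ∫ x, f x * fderiv ℝ ψ x e = - ∫ x, ψ x * w x

lemma HasWeakGradOn.sw {f : 𝔼 → ℝ} {v : 𝔼 → 𝔼} {Ω : Set 𝔼} (h : HasWeakGradOn f v Ω) (i : Fin n) :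
    SW f (fun x => v x i) (EuclideanSpace.single i 1) Ω := by
  obtain ⟨hf, hv, hw⟩ := h
  let P : 𝔼 →L[ℝ] ℝ := EuclideanSpace.proj i
  refine ⟨hf, ?_, ?_⟩
  · intro x hx
    obtain ⟨s, hs, hi⟩ := hv x hx
    exact ⟨s, hs, P.integrable_comp hi⟩
  · intro ψ hψ hψc hψs
    have hψ1 : ContDiff ℝ 1 ψ := hψ.of_le (by exact_mod_cast le_top)
    have h0 := hw ψ hψ hψc hψs
    have gc : Continuous (gradient ψ) :=
      (InnerProductSpace.toDual ℝ 𝔼).symm.continuous.comp (hψ1.continuous_fderiv one_ne_zero)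
    have gs : tsupport (gradient ψ) ⊆ tsupport ψ := by
      refine (closure_mono ?_).trans (tsupport_fderiv_subset ℝ (f := ψ))
      intro x hx hx'
      exact hx (by simp [gradient, hx'])
    have gcs : HasCompactSupport (gradient ψ) := hψc.of_isClosed_subset (isClosed_tsupport _) gs
    rw [setIntegral_eq_integral_of_forall_compl_eq_zero,
      setIntegral_eq_integral_of_forall_compl_eq_zero] at h0
    rotate_left
    · intro x hx
      rw [image_eq_zero_of_notMem_tsupport (fun h => hx (hψs h)), zero_smul]
    · intro x hx
      rw [image_eq_zero_of_notMem_tsupport (fun h => hx (hψs (gs h))), smul_zero]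
    have h1 := congrArg P h0
    rw [map_neg, ← P.integral_comp_comm (int_aux_r hf gc gcs (gs.trans hψs)),
      ← P.integral_comp_comm (int_aux_l hv hψ.continuous hψc hψs)] at h1
    simp only [map_smul, smul_eq_mul] at h1
    have e1 : ∀ x, P (gradient ψ x) = fderiv ℝ ψ x (EuclideanSpace.single i 1) := by
      intro x
      rw [← inner_gradient_left]
      rw [EuclideanSpace.inner_single_right]; simp [P]
    simp only [e1] at h1
    exact h1

lemma SW.zero {f w : 𝔼 → ℝ} {e : 𝔼} {Ω : Set 𝔼} (hΩ : IsOpen Ω) (h : SW f w e Ω) :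
    ∀ᵐ x, x ∈ Ω → f x = 0 → w x = 0 := by
  obtain ⟨hf, hv, hw⟩ := h
  have key : ∀ χ : 𝔼 → ℝ, ContDiff ℝ (⊤ : ℕ∞) χ → HasCompactSupport χ → tsupport χ ⊆ Ω →
      ∀ᵐ x, f x = 0 → χ x ≠ 0 → w x = 0 := by
    intro χ hχ hχc hχs
    have hχ1 : ContDiff ℝ 1 χ := hχ.of_le (by exact_mod_cast le_top)
    have hχe : Continuous fun x => fderiv ℝ χ x e :=
      (hχ1.continuous_fderiv one_ne_zero).clm_apply continuous_const
    have hχec : HasCompactSupport fun x => fderiv ℝ χ x e := hχc.fderiv_apply ℝ e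
    have hχes : tsupport (fun x => fderiv ℝ χ x e) ⊆ Ω :=
      (tsupport_fderiv_apply_subset ℝ e).trans hχs
    have i1 : Integrable (fun x => χ x * f x) := int_aux_l hf hχ.continuous hχc hχs
    have i2 : Integrable (fun x => χ x * w x) := int_aux_l hv hχ.continuous hχc hχs
    have i3 : Integrable (fun x => fderiv ℝ χ x e * f x) := int_aux_l hf hχe hχec hχes
    have := zero_global i1 (i2.add i3) e ?_
    · filter_upwards [this] with x hx h0 h1
      have := hx (by simp [h0])
      simp [h0] at this
      exact this.resolve_left h1
    · intro ψ hψ hψc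
      have hψ1 : ContDiff ℝ 1 ψ := hψ.of_le (by exact_mod_cast le_top)
      obtain ⟨D, hD⟩ := hψc.exists_bound_of_continuous hψ.continuous
      have h0 := hw (fun x => χ x * ψ x) (hχ.mul hψ) hχc.mul_right
        ((tsupport_mul_subset_left).trans hχs)
      have hd : ∀ x, fderiv ℝ (fun x => χ x * ψ x) x e
          = χ x * fderiv ℝ ψ x e + ψ x * fderiv ℝ χ x e := by
        intro x
        rw [fderiv_fun_mul (hχ1.differentiable one_ne_zero x) (hψ1.differentiable one_ne_zero x)]
        simp
      have hψe : Continuous fun x => fderiv ℝ ψ x e :=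
        (hψ1.continuous_fderiv one_ne_zero).clm_apply continuous_const
      have j1 : Integrable fun x => χ x * f x * fderiv ℝ ψ x e :=
        i1.locallyIntegrable.integrable_smul_right_of_hasCompactSupport hψe (hψc.fderiv_apply ℝ e)
      have j2 : Integrable fun x => ψ x * (χ x * w x) :=
        i2.locallyIntegrable.integrable_smul_left_of_hasCompactSupport hψ.continuous hψc
      have j3 : Integrable fun x => ψ x * (fderiv ℝ χ x e * f x) :=
        i3.locallyIntegrable.integrable_smul_left_of_hasCompactSupport hψ.continuous hψc
      have e1 : ∫ x, f x * fderiv ℝ (fun x => χ x * ψ x) x e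
          = (∫ x, χ x * f x * fderiv ℝ ψ x e) + ∫ x, ψ x * (fderiv ℝ χ x e * f x) := by
        rw [← integral_add j1 j3]
        congr 1; ext x; rw [hd]; ring
      have e2 : ∫ x, ψ x * ((fun x => χ x * w x) + fun x => fderiv ℝ χ x e * f x) x
          = (∫ x, ψ x * (χ x * w x)) + ∫ x, ψ x * (fderiv ℝ χ x e * f x) := by
        rw [← integral_add j2 j3]
        congr 1; ext x; simp only [Pi.add_apply]; ring
      have e3 : ∫ x, χ x * ψ x * w x = ∫ x, ψ x * (χ x * w x) := by
        congr 1; ext x; ring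
      rw [e2]
      rw [e1, e3] at h0
      linarith
  rw [ae_iff]
  refine measure_null_of_locally_null _ fun x hx => ?_
  have hxΩ : x ∈ Ω := by
    by_contra hh
    exact hx fun h => absurd h hh
  obtain ⟨χ, h1, h2, h3, -, h5⟩ := exists_contDiff_tsupport_subset (n := ⊤) (hΩ.mem_nhds hxΩ)
  have hk := key χ h3 h2 h1
  rw [ae_iff] at hk
  have hopen : {y | χ y ≠ 0} ∈ 𝓝 x :=
    (isOpen_ne_fun h3.continuous continuous_const).mem_nhds (by simp [h5])
  refine ⟨{y | ¬ (y ∈ Ω → f y = 0 → w y = 0)} ∩ {y | χ y ≠ 0},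
    inter_mem self_mem_nhdsWithin (mem_nhdsWithin_of_mem_nhds hopen), ?_⟩
  refine measure_mono_null ?_ hk
  rintro y ⟨hy1, hy2⟩ hy3
  exact hy1 fun _ h => hy3 h hy2

lemma integral_fderiv_zero {ψ : 𝔼 → ℝ} (hψ : ContDiff ℝ (⊤ : ℕ∞) ψ) (hψc : HasCompactSupport ψ)
    (e : 𝔼) : ∫ x, fderiv ℝ ψ x e = 0 := by
  have hψ1 : ContDiff ℝ 1 ψ := hψ.of_le (by exact_mod_cast le_top)
  have hψe : Continuous fun x => fderiv ℝ ψ x e :=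
    (hψ1.continuous_fderiv one_ne_zero).clm_apply continuous_const
  have := integral_mul_fderiv_eq_neg_fderiv_mul_of_integrable (μ := (volume : Measure 𝔼))
    (f := fun _ : 𝔼 => (1:ℝ)) (g := ψ) (v := e) (by simp)
    (by simpa using hψe.integrable_of_hasCompactSupport (hψc.fderiv_apply ℝ e))
    (by simpa using hψ.continuous.integrable_of_hasCompactSupport hψc)
    (fun x _ => differentiableAt_const _) (fun x _ => hψ1.differentiable one_ne_zero x)
  simpa using this

lemma SW.eq {f w g w' : 𝔼 → ℝ} {e : 𝔼} {Ω : Set 𝔼} (hΩ : IsOpen Ω) (h : SW f w e Ω)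
    (h' : SW g w' e Ω) (s c : ℝ) :
    ∀ᵐ x, x ∈ Ω → g x = s * (f x - c) → w' x = s * w x := by
  have hc : LocallyIntegrableOn (fun _ : 𝔼 => c) Ω := (locallyIntegrable_const c).locallyIntegrableOn _
  have hsw : SW (fun x => g x - s * (f x - c)) (fun x => w' x - s * w x) e Ω := by
    have l1 : LocallyIntegrableOn (fun x => s * (f x - c)) Ω := (h.1.sub hc).smul s
    have l2 : LocallyIntegrableOn (fun x => s * w x) Ω := (h.2.1).smul s
    refine ⟨h'.1.sub l1, h'.2.1.sub l2, ?_⟩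
    intro ψ hψ hψc hψs
    have hψ1 : ContDiff ℝ 1 ψ := hψ.of_le (by exact_mod_cast le_top)
    have hψe : Continuous fun x => fderiv ℝ ψ x e :=
      (hψ1.continuous_fderiv one_ne_zero).clm_apply continuous_const
    have hψec : HasCompactSupport fun x => fderiv ℝ ψ x e := hψc.fderiv_apply ℝ e
    have hψes : tsupport (fun x => fderiv ℝ ψ x e) ⊆ Ω :=
      (tsupport_fderiv_apply_subset ℝ e).trans hψs
    have a1 : Integrable fun x => g x * fderiv ℝ ψ x e := int_aux_r h'.1 hψe hψec hψes
    have a2 : Integrable fun x => f x * fderiv ℝ ψ x e := int_aux_r h.1 hψe hψec hψes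
    have a3 : Integrable fun x => fderiv ℝ ψ x e := hψe.integrable_of_hasCompactSupport hψec
    have a4 : Integrable fun x => ψ x * w' x := int_aux_l h'.2.1 hψ.continuous hψc hψs
    have a5 : Integrable fun x => ψ x * w x := int_aux_l h.2.1 hψ.continuous hψc hψs
    have a6 : Integrable fun x => g x * fderiv ℝ ψ x e - s * (f x * fderiv ℝ ψ x e) :=
      a1.sub (a2.const_mul s)
    have e1 : ∫ x, (g x - s * (f x - c)) * fderiv ℝ ψ x e
        = (∫ x, g x * fderiv ℝ ψ x e) - s * (∫ x, f x * fderiv ℝ ψ x e)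
          + s * c * ∫ x, fderiv ℝ ψ x e := by
      rw [← integral_const_mul, ← integral_const_mul, ← integral_sub a1 (a2.const_mul s),
        ← integral_add a6 (a3.const_mul _)]
      congr 1; ext x; ring
    have e2 : ∫ x, ψ x * (w' x - s * w x) = (∫ x, ψ x * w' x) - s * ∫ x, ψ x * w x := by
      rw [← integral_const_mul, ← integral_sub a4 (a5.const_mul s)]
      congr 1; ext x; ring
    rw [e1, e2, h.2.2 ψ hψ hψc hψs, h'.2.2 ψ hψ hψc hψs, integral_fderiv_zero hψ hψc]
    ring
  filter_upwards [hsw.zero hΩ] with x hx hxΩ hxe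
  exact sub_eq_zero.1 (hx hxΩ (sub_eq_zero.2 hxe))

lemma HasWeakGradOn.norm_eq {f g : 𝔼 → ℝ} {v w : 𝔼 → 𝔼} {Ω : Set 𝔼} (hΩ : IsOpen Ω)
    (h : HasWeakGradOn f v Ω) (h' : HasWeakGradOn g w Ω) (c : ℤ → ℝ) :
    ∀ᵐ x, x ∈ Ω → (∃ m, g x = |f x - c m|) → ‖w x‖ = ‖v x‖ := by
  have h1 : ∀ᵐ x, ∀ (m : ℤ) (i : Fin n), x ∈ Ω → g x = 1 * (f x - c m) → w x i = 1 * v x i := by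
    rw [ae_all_iff]; intro m
    rw [ae_all_iff]; intro i
    exact (h.sw i).eq hΩ (h'.sw i) 1 (c m)
  have h2 : ∀ᵐ x, ∀ (m : ℤ) (i : Fin n), x ∈ Ω → g x = (-1) * (f x - c m) →
      w x i = (-1) * v x i := by
    rw [ae_all_iff]; intro m
    rw [ae_all_iff]; intro i
    exact (h.sw i).eq hΩ (h'.sw i) (-1) (c m)
  filter_upwards [h1, h2] with x h1 h2 hx ⟨m, hm⟩
  rcases abs_choice (f x - c m) with ha | ha
  · have : w x = v x := by
      ext i; simpa using h1 m i hx (by rw [hm, ha, one_mul])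
    rw [this]
  · have : w x = - v x := by
      ext i; simpa using h2 m i hx (by rw [hm, ha]; ring)
    rw [this, norm_neg]

end loc

/-- the sawtooth function -/
def saw (ε t : ℝ) : ℝ := Metric.infDist t (range fun m : ℤ => 2 * ε * (m:ℝ))

lemma saw_eq {ε : ℝ} (hε : 0 < ε) (t : ℝ) : ∃ m : ℤ, saw ε t = |t - 2 * ε * m| := by
  refine ⟨round (t / (2 * ε)), le_antisymm ?_ ?_⟩
  · exact Metric.infDist_le_dist_of_mem (mem_range_self _)
  · refine (Metric.le_infDist (range_nonempty _)).2 ?_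
    rintro _ ⟨m, rfl⟩
    have h := round_le (t / (2 * ε)) m
    rw [Real.dist_eq]
    have e : ∀ k : ℤ, |t - 2 * ε * k| = 2 * ε * |t / (2 * ε) - k| := by
      intro k
      rw [← abs_of_pos (show 0 < 2 * ε by positivity), ← abs_mul,
        abs_of_pos (show 0 < 2 * ε by positivity)]
      congr 1; field_simp
    simp only [e]
    gcongr

lemma saw_le {ε : ℝ} (hε : 0 < ε) (t : ℝ) : saw ε t ≤ ε := by
  refine (Metric.infDist_le_dist_of_mem (mem_range_self (round (t / (2 * ε))))).trans ?_
  have h := abs_sub_round (t / (2 * ε))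
  rw [Real.dist_eq]
  have e : ∀ k : ℤ, |t - 2 * ε * k| = 2 * ε * |t / (2 * ε) - k| := by
    intro k
    rw [← abs_of_pos (show 0 < 2 * ε by positivity), ← abs_mul,
      abs_of_pos (show 0 < 2 * ε by positivity)]
    congr 1; field_simp
  rw [e]
  nlinarith

lemma saw_nonneg (ε t : ℝ) : 0 ≤ saw ε t := Metric.infDist_nonneg

lemma saw_lip (ε : ℝ) : LipschitzWith 1 (saw ε) := Metric.lipschitz_infDist_pt _

lemma dist_pos_of {Y : Type*} [MetricSpace Y] {V : Set Y} {u : Y → ℝ} {ε : ℝ} (hε : 0 < ε)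
    (hu : ∀ y, u y ≠ 0 → ε ≤ Metric.infDist y Vᶜ) : 0 < eSetDist (tsupport u) Vᶜ := by
  have h1 : ∀ y ∈ tsupport u, ε ≤ Metric.infDist y Vᶜ := by
    have hc : IsClosed {y | ε ≤ Metric.infDist y Vᶜ} :=
      isClosed_le continuous_const (Metric.continuous_infDist_pt _)
    exact fun y hy => closure_minimal hu hc hy
  refine lt_of_lt_of_le (ENNReal.ofReal_pos.2 hε) ?_
  refine le_iInf₂ fun y hy => le_iInf₂ fun z hz => ?_
  rw [edist_dist]
  exact ENNReal.ofReal_le_ofReal ((h1 y hy).trans (Metric.infDist_le_dist_of_mem hz))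

/-- key lemma. If the bound `∫_{φ⁻¹(V)} ‖∇(u∘φ)‖^q ≤ A` holds for all
`1`-Lipschitz `u` whose support stays away from `Y∖V`, then it holds for all `1`-Lipschitz
`u` (such that `u∘φ` has a weak gradient with `q`-integrable norm). -/
theorem bound_for_all_lipschitz_of_bound_for_supported
    {n : ℕ} (hn : 0 < n) {Y : Type*} [MetricSpace Y]
    (Ω : Set (EuclideanSpace ℝ (Fin n))) (hΩo : IsOpen Ω) (hΩc : IsConnected Ω)
    (φ : EuclideanSpace ℝ (Fin n) → Y) (V : Set Y) (hV : IsOpen V)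
    (A : ℝ) (hA : 0 ≤ A) (q : ℝ) (hq : 1 ≤ q)
    (hyp : ∀ u : Y → ℝ, LipschitzWith 1 u → 0 < eSetDist (tsupport u) Vᶜ →
      ∃ v, HasWeakGradOn (u ∘ φ) v Ω ∧ IntegrableOn (fun x => ‖v x‖ ^ q) Ω volume ∧
        ∫ x in Ω ∩ φ ⁻¹' V, ‖v x‖ ^ q ≤ A) :
    ∀ u : Y → ℝ, LipschitzWith 1 u →
      ∀ v : EuclideanSpace ℝ (Fin n) → EuclideanSpace ℝ (Fin n),
        HasWeakGradOn (u ∘ φ) v Ω → IntegrableOn (fun x => ‖v x‖ ^ q) Ω volume →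
        ∫ x in Ω ∩ φ ⁻¹' V, ‖v x‖ ^ q ≤ A := by
  classical
  intro u hu v hv hvi
  -- integral comparison on a subset where norms agree
  have comp : ∀ (S : Set (EuclideanSpace ℝ (Fin n))), S ⊆ Ω ∩ φ ⁻¹' V → NullMeasurableSet S →
      ∀ w : EuclideanSpace ℝ (Fin n) → EuclideanSpace ℝ (Fin n),
      IntegrableOn (fun x => ‖w x‖ ^ q) Ω volume →
      ∫ x in Ω ∩ φ ⁻¹' V, ‖w x‖ ^ q ≤ A → (∀ᵐ x, x ∈ S → ‖w x‖ = ‖v x‖) →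
      ∫ x in S, ‖v x‖ ^ q ≤ A := by
    intro S hS hSm w hwi hwA hae
    have : ∫ x in S, ‖v x‖ ^ q = ∫ x in S, ‖w x‖ ^ q := by
      refine setIntegral_congr_ae₀ hSm ?_
      filter_upwards [hae] with x hx hxS
      rw [hx hxS]
    rw [this]
    refine le_trans (setIntegral_mono_set (hwi.mono_set inter_subset_left) ?_ ?_) hwA
    · exact Filter.Eventually.of_forall fun x => by positivity
    · exact Filter.Eventually.of_forall hS
  rcases (Vᶜ).eq_empty_or_nonempty with hVe | hVne
  · obtain ⟨w, hw, hwi, hwA⟩ := hyp u hu (by simp [hVe, eSetDist])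
    have hVu : V = univ := compl_empty_iff.1 hVe
    refine comp _ subset_rfl ?_ w hwi hwA ?_
    · simpa [hVu] using hΩo.measurableSet.nullMeasurableSet
    · have hw' : ∀ i, _ := fun i => (hv.sw i).eq hΩo (hw.sw i) 1 0
      rw [← ae_all_iff] at hw'
      filter_upwards [hw'] with x hx hxS
      congr 1
      ext i
      simpa using hx i hxS.1 (by simp)
  · let d : Y → ℝ := fun y => Metric.infDist y Vᶜ
    have hd : LipschitzWith 1 d := Metric.lipschitz_infDist_pt _
    have hdV : ∀ y, 0 < d y ↔ y ∈ V := by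
      intro y
      rw [← hV.isClosed_compl.notMem_iff_infDist_pos hVne, mem_compl_iff, not_not]
    have hdε : ∀ ε, LipschitzWith 1 fun y => max (d y - ε) 0 := by
      intro ε
      have : LipschitzWith 1 fun y => d y - ε := by
        refine LipschitzWith.of_dist_le_mul fun x y => ?_
        simpa [Real.dist_eq] using hd.dist_le_mul x y
      exact this.max_const 0
    let ε : ℕ → ℝ := fun k => 1 / ((k:ℝ) + 1)
    have hε : ∀ k, 0 < ε k := fun k => by positivity
    have hεa : Antitone ε := fun a b hab => Nat.one_div_le_one_div hab
    let S : ℕ → Set (EuclideanSpace ℝ (Fin n)) := fun k => Ω ∩ {x | 2 * ε k < d (φ x)}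
    have hSsub : ∀ k, S k ⊆ Ω ∩ φ ⁻¹' V := fun k x hx =>
      ⟨hx.1, (hdV _).1 (lt_trans (by have := hε k; positivity) hx.2)⟩
    have hSm : ∀ k, NullMeasurableSet (S k) := by
      intro k
      obtain ⟨w, hw, -, -⟩ := hyp (fun y => max (d y - ε k) 0) (hdε _) (dist_pos_of (hε k) (by
        intro y hy
        by_contra! h
        exact hy (max_eq_right (by linarith))))
      have hm : AEMeasurable ((fun y => max (d y - ε k) 0) ∘ φ) (volume.restrict Ω) :=
        hw.1.aestronglyMeasurable.aemeasurable
      have h1 := hm.nullMeasurable (measurableSet_Ioi (a := ε k))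
      have h2 := (nullMeasurableSet_restrict hΩo.measurableSet.nullMeasurableSet).1 h1
      convert h2 using 1
      ext x
      simp only [S, mem_inter_iff, mem_ofPred_eq, mem_preimage, Function.comp, mem_Ioi, lt_max_iff]
      have := hε k
      constructor
      · rintro ⟨a, b⟩
        exact ⟨Or.inl (by linarith), a⟩
      · rintro ⟨a | a, b⟩
        · exact ⟨b, by linarith⟩
        · linarith
    have hSmono : Monotone S := fun a b hab x hx =>
      ⟨hx.1, lt_of_le_of_lt (mul_le_mul_of_nonneg_left (hεa hab) zero_le_two) hx.2⟩
    have hSU : ⋃ k, S k = Ω ∩ φ ⁻¹' V := by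
      refine subset_antisymm (iUnion_subset hSsub) ?_
      rintro x ⟨hx, hxV⟩
      have hp := (hdV _).2 hxV
      obtain ⟨k, hk⟩ := exists_nat_one_div_lt (half_pos hp)
      refine mem_iUnion.2 ⟨k, hx, ?_⟩
      simp only [mem_ofPred_eq, ε]
      linarith
    have hb : ∀ k, ∫ x in S k, ‖v x‖ ^ q ≤ A := by
      intro k
      have hk := hε k
      obtain ⟨w, hw, hwi, hwA⟩ := hyp (fun y => min (saw (ε k) (u y)) (max (d y - ε k) 0)) (by
        have h1 : LipschitzWith 1 fun y => saw (ε k) (u y) := by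
          simpa [Function.comp_def] using (saw_lip (ε k)).comp hu
        simpa using h1.min (hdε (ε k))) (dist_pos_of hk (by
        intro y hy
        by_contra! h
        apply hy
        have : d y < ε k := h
        rw [max_eq_right (by linarith)]
        exact min_eq_right (saw_nonneg _ _)))
      refine comp (S k) (hSsub k) (hSm k) w hwi hwA ?_
      filter_upwards [hv.norm_eq hΩo hw (fun m => 2 * ε k * (m:ℝ))] with x hx hxS
      refine hx hxS.1 ?_
      obtain ⟨m, hm⟩ := saw_eq hk (u (φ x))
      refine ⟨m, ?_⟩
      simp only [Function.comp]
      rw [← hm]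
      refine min_eq_left ((saw_le hk _).trans (le_max_of_le_left ?_))
      have := hxS.2
      simp only [mem_ofPred_eq] at this
      linarith
    have hlim := tendsto_setIntegral_of_monotone₀ (f := fun x => ‖v x‖ ^ q) (μ := volume)
      hSm hSmono (by rw [hSU]; exact hvi.mono_set inter_subset_left)
    rw [hSU] at hlim
    exact le_of_tendsto' hlim hb
end
end

section
/- Let Ω ⊆ ℝⁿ be a domain, (Y,d) a metric space, 1 ≤ q < ∞, K ≥ 0, and φ : Ω → Y a mapping such that for every Lipschitz u : Y → ℝ the composition u∘φ is locally integrable on Ω and has a weak gradient v_u with (∫_Ω ‖v_u‖^q dx)^{1/q} ≤ K·Lip(u). Then for every open set V ⊆ Y and every Lipschitz u : Y → ℝ, one has ∫_{φ⁻¹(V)} ‖v_u(x)‖^q dx ≤ Lip(u)^q · Φ(V). -/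
open MeasureTheory Set
open scoped ENNReal Topology NNReal
noncomputable section

open Filter in
lemma aux_L1_tendsto {α : Type*} [MeasurableSpace α] {μ : Measure α} {g : α → ℝ} {G : ℕ → α → ℝ}
    (hg : Integrable g μ) (hG : ∀ k, Integrable (G k) μ)
    (hae : ∀ᵐ x ∂μ, Tendsto (fun k => G k x) atTop (𝓝 (g x)))
    (hle : ∀ k, ∫ x, |G k x| ∂μ ≤ ∫ x, |g x| ∂μ) :
    Tendsto (fun k => ∫ x, |G k x - g x| ∂μ) atTop (𝓝 0) := by
  have h1 : Tendsto (fun k => ∫ x, (|G k x - g x| - |G k x|) ∂μ) atTop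
      (𝓝 (∫ x, (- |g x|) ∂μ)) := by
    refine tendsto_integral_of_dominated_convergence (fun x => |g x|) ?_ hg.abs ?_ ?_
    · intro k
      exact (((hG k).sub hg).abs.sub (hG k).abs).aestronglyMeasurable
    · intro k
      filter_upwards with x
      rw [Real.norm_eq_abs]
      have := abs_abs_sub_abs_le_abs_sub (G k x - g x) (G k x)
      simpa using this
    · filter_upwards [hae] with x hx
      have : Tendsto (fun k => |G k x - g x| - |G k x|) atTop (𝓝 (|g x - g x| - |g x|)) :=
        (hx.sub_const _).abs.sub hx.abs
      simpa using this
  rw [integral_neg] at h1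
  have h2 := h1.add_const (∫ x, |g x| ∂μ)
  rw [neg_add_cancel] at h2
  refine squeeze_zero (fun k => integral_nonneg (fun x => abs_nonneg _)) (fun k => ?_) h2
  have h3 : Integrable (fun x => |G k x - g x|) μ := ((hG k).sub hg).abs
  rw [integral_sub h3 (hG k).abs]
  linarith [hle k]

open Filter Convolution ContinuousLinearMap in
lemma aux_global {n : ℕ} (e : EuclideanSpace ℝ (Fin n)) {F G : EuclideanSpace ℝ (Fin n) → ℝ}
    (hF : Integrable F) (hG : Integrable G)
    (h : ∀ ψ : EuclideanSpace ℝ (Fin n) → ℝ, ContDiff ℝ (⊤ : ℕ∞) ψ → HasCompactSupport ψ →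
      ∫ x, F x * fderiv ℝ ψ x e = - ∫ x, ψ x * G x) :
    ∀ᵐ x, F x = 0 → G x = 0 := by
  let b : ℕ → ContDiffBump (0 : EuclideanSpace ℝ (Fin n)) := fun k =>
    ⟨1 / ((k : ℝ) + 1), 2 * (1 / ((k : ℝ) + 1)), by positivity, by
      have : 0 < 1 / ((k : ℝ) + 1) := by positivity
      linarith⟩
  let η : ℕ → EuclideanSpace ℝ (Fin n) → ℝ := fun k => (b k).normed volume
  have hηc : ∀ k, HasCompactSupport (η k) := fun k => (b k).hasCompactSupport_normed
  have hηs : ∀ k, ContDiff ℝ (⊤ : ℕ∞) (η k) := fun k => (b k).contDiff_normed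
  have hηi : ∀ k, Integrable (η k) := fun k => (b k).integrable_normed
  have hbr : Tendsto (fun k => (b k).rOut) atTop (𝓝 0) := by
    have := (tendsto_one_div_add_atTop_nhds_zero_nat (𝕜 := ℝ)).const_mul 2
    rw [mul_zero] at this
    exact this
  have hbK : ∀ᶠ k in atTop, (b k).rOut ≤ 2 * (b k).rIn := Eventually.of_forall fun k => le_rfl
  let Fk : ℕ → EuclideanSpace ℝ (Fin n) → ℝ := fun k => (η k) ⋆[lsmul ℝ ℝ, volume] F
  let Gk : ℕ → EuclideanSpace ℝ (Fin n) → ℝ := fun k => (η k) ⋆[lsmul ℝ ℝ, volume] G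
  have hFae : ∀ᵐ x, Tendsto (fun k => Fk k x) atTop (𝓝 (F x)) :=
    ContDiffBump.ae_convolution_tendsto_right_of_locallyIntegrable hbr hbK hF.locallyIntegrable
  have hGae : ∀ᵐ x, Tendsto (fun k => Gk k x) atTop (𝓝 (G x)) :=
    ContDiffBump.ae_convolution_tendsto_right_of_locallyIntegrable hbr hbK hG.locallyIntegrable
  have hFs : ∀ k, ContDiff ℝ (⊤ : ℕ∞) (Fk k) := fun k =>
    (hηc k).contDiff_convolution_left _ (hηs k) hF.locallyIntegrable
  have hGs : ∀ k, ContDiff ℝ (⊤ : ℕ∞) (Gk k) := fun k =>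
    (hηc k).contDiff_convolution_left _ (hηs k) hG.locallyIntegrable
  have hGi : ∀ k, Integrable (Gk k) := fun k => (hηi k).integrable_convolution _ hG
  have hGle : ∀ k, ∫ x, |Gk k x| ≤ ∫ x, |G x| := by
    intro k
    have h1 : ∫ x, ((η k) ⋆[lsmul ℝ ℝ, volume] (fun y => |G y|)) x = ∫ x, |G x| := by
      rw [integral_convolution _ (hηi k) hG.abs]
      simp [η, (b k).integral_normed]
    rw [← h1]
    refine integral_mono (hGi k).abs ((hηi k).integrable_convolution _ hG.abs) (fun x => ?_)
    refine (abs_integral_le_integral_abs (f := fun t => lsmul ℝ ℝ (η k t) (G (x - t)))).trans ?_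
    refine le_of_eq ?_
    refine integral_congr_ae (Eventually.of_forall fun t => ?_)
    simp [abs_mul, abs_of_nonneg ((b k).nonneg_normed t), η]
  have hGL1 := aux_L1_tendsto hG hGi hGae hGle
  have hder : ∀ k x, fderiv ℝ (Fk k) x e = Gk k x := by
    intro k x
    have hd := (hηc k).hasFDerivAt_convolution_right (lsmul ℝ ℝ).flip hF.locallyIntegrable
      ((hηs k).of_le (by exact_mod_cast le_top)) x
    rw [convolution_flip] at hd
    change HasFDerivAt (Fk k) _ x at hd
    rw [hd.fderiv, convolution_precompR_apply _ hF.locallyIntegrable ((hηc k).fderiv ℝ)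
      ((hηs k).continuous_fderiv (by simp))]
    have hψ := h (fun y => η k (x - y)) ((hηs k).comp (contDiff_const.sub contDiff_id)) (by
      exact (hηc k).comp_homeomorph (Homeomorph.subLeft x))
    have hfd : ∀ y, fderiv ℝ (fun y => η k (x - y)) y e = - fderiv ℝ (η k) (x - y) e := by
      intro y
      have h1 := ((hηs k).differentiable (by simp) (x - y)).hasFDerivAt.comp y
        ((hasFDerivAt_id y).const_sub x)
      have h2 : fderiv ℝ (fun y => η k (x - y)) y = _ := h1.fderiv
      rw [h2]
      simp
    simp only [hfd, mul_neg, integral_neg, neg_inj] at hψ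
    simp only [Gk]
    refine Eq.trans ?_ (hψ.trans ?_)
    · simp [convolution, mul_comm]
    · rw [convolution_eq_swap]
      simp
  -- chain rule
  have hchain : ∀ (δ : ℝ), 0 < δ → ∀ ψ : EuclideanSpace ℝ (Fin n) → ℝ,
      ContDiff ℝ (⊤ : ℕ∞) ψ → HasCompactSupport ψ →
      ∫ x, δ * Real.arctan (F x / δ) * fderiv ℝ ψ x e =
        - ∫ x, (1 / (1 + (F x / δ)^2)) * G x * ψ x := by
    intro δ hδ ψ hψ hψc
    have hψ'c : Continuous (fun x => fderiv ℝ ψ x e) :=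
      (hψ.continuous_fderiv (by simp)).clm_apply continuous_const
    have hψ's : HasCompactSupport (fun x => fderiv ℝ ψ x e) := hψc.fderiv_apply ℝ e
    have hψ'i : Integrable (fun x => fderiv ℝ ψ x e) := hψ'c.integrable_of_hasCompactSupport hψ's
    obtain ⟨C, hC⟩ := hψc.exists_bound_of_continuous hψ.continuous
    have hC0 : 0 ≤ C := (norm_nonneg _).trans (hC 0)
    have hFd : ∀ k x, HasFDerivAt (fun x => δ * Real.arctan (Fk k x / δ))
        ((1 / (1 + (Fk k x / δ)^2)) • fderiv ℝ (Fk k) x) x := by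
      intro k x
      have h1 : HasDerivAt (fun t : ℝ => δ * Real.arctan (t / δ)) (1 / (1 + (Fk k x / δ)^2)) (Fk k x) := by
        have := (((hasDerivAt_id (Fk k x)).div_const δ).arctan).const_mul δ
        refine HasDerivAt.congr_deriv this ?_
        simp only [id]
        field_simp
      exact h1.comp_hasFDerivAt x ((hFs k).differentiable (by simp) x).hasFDerivAt
    have hcont : ∀ k, Continuous (fun x => δ * Real.arctan (Fk k x / δ)) := fun k =>
      continuous_const.mul (Real.continuous_arctan.comp ((hFs k).continuous.div_const δ))
    have hcont2 : ∀ k, Continuous (fun x => 1 / (1 + (Fk k x / δ)^2)) := fun k =>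
      Continuous.div continuous_const (continuous_const.add (((hFs k).continuous.div_const δ).pow 2))
        (fun x => by positivity)
    have hk : ∀ k, ∫ x, δ * Real.arctan (Fk k x / δ) * fderiv ℝ ψ x e =
        - ∫ x, (1 / (1 + (Fk k x / δ)^2)) * Gk k x * ψ x := by
      intro k
      have hf' : ∀ x, fderiv ℝ (fun x => δ * Real.arctan (Fk k x / δ)) x e =
          (1 / (1 + (Fk k x / δ)^2)) * Gk k x := by
        intro x
        rw [(hFd k x).fderiv]
        simp [hder]
      rw [integral_mul_fderiv_eq_neg_fderiv_mul_of_integrable]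
      · simp only [hf']
      · simp only [hf']
        exact (((hcont2 k).mul (hGs k).continuous).mul hψ.continuous).integrable_of_hasCompactSupport
          hψc.mul_left
      · exact ((hcont k).mul hψ'c).integrable_of_hasCompactSupport hψ's.mul_left
      · exact ((hcont k).mul hψ.continuous).integrable_of_hasCompactSupport hψc.mul_left
      · exact fun x _ => (hFd k x).differentiableAt
      · exact fun x _ => hψ.differentiable (by simp) x
    have hA : Tendsto (fun k => ∫ x, δ * Real.arctan (Fk k x / δ) * fderiv ℝ ψ x e) atTop
        (𝓝 (∫ x, δ * Real.arctan (F x / δ) * fderiv ℝ ψ x e)) := by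
      refine tendsto_integral_of_dominated_convergence
        (fun x => δ * (Real.pi / 2) * ‖fderiv ℝ ψ x e‖) ?_ (hψ'i.norm.const_mul _) ?_ ?_
      · exact fun k => ((hcont k).mul hψ'c).aestronglyMeasurable
      · intro k
        filter_upwards with x
        rw [norm_mul, norm_mul, Real.norm_eq_abs, abs_of_pos hδ, Real.norm_eq_abs]
        gcongr
        exact abs_le.2 ⟨(Real.neg_pi_div_two_lt_arctan _).le, (Real.arctan_lt_pi_div_two _).le⟩
      · filter_upwards [hFae] with x hx
        exact (((Real.continuous_arctan.tendsto _).comp (hx.div_const δ)).const_mul δ).mul_const _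
    have hinv : ∀ t : ℝ, |1 / (1 + t^2)| ≤ 1 := by
      intro t
      rw [abs_of_pos (by positivity), div_le_one (by positivity)]
      nlinarith [sq_nonneg t]
    have hB1 : Tendsto (fun k => ∫ x, (1 / (1 + (Fk k x / δ)^2)) * G x * ψ x) atTop
        (𝓝 (∫ x, (1 / (1 + (F x / δ)^2)) * G x * ψ x)) := by
      refine tendsto_integral_of_dominated_convergence
        (fun x => 1 * |G x| * C) ?_ ((hG.abs.const_mul _).mul_const _) ?_ ?_
      · exact fun k => ((hcont2 k).aestronglyMeasurable.mul hG.aestronglyMeasurable).mul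
          hψ.continuous.aestronglyMeasurable
      · intro k
        filter_upwards with x
        rw [norm_mul, norm_mul]
        gcongr
        · exact hinv _
        · exact le_rfl
        · exact hC x
      · filter_upwards [hFae] with x hx
        refine (Tendsto.mul_const _ (tendsto_const_nhds.div ?_ (by positivity))).mul_const _
        exact tendsto_const_nhds.add ((hx.div_const δ).pow 2)
    have hB2 : Tendsto (fun k => ∫ x, (1 / (1 + (Fk k x / δ)^2)) * (Gk k x - G x) * ψ x) atTop
        (𝓝 0) := by
      have := hGL1.const_mul C
      rw [mul_zero] at this
      refine squeeze_zero_norm (fun k => ?_) this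
      rw [← integral_const_mul]
      refine norm_integral_le_of_norm_le (((hGi k).sub hG).abs.const_mul C) ?_
      filter_upwards with x
      rw [norm_mul, norm_mul]
      calc _ ≤ 1 * |Gk k x - G x| * C := by
            gcongr
            · exact hinv _
            · exact le_rfl
            · exact hC x
        _ = _ := by ring
    have hbint : ∀ k (g : EuclideanSpace ℝ (Fin n) → ℝ), Integrable g →
        Integrable (fun x => (1 / (1 + (Fk k x / δ)^2)) * g x * ψ x) := by
      intro k g hg
      refine (hg.norm.mul_const C).mono' (((hcont2 k).aestronglyMeasurable.mul
        hg.aestronglyMeasurable).mul hψ.continuous.aestronglyMeasurable) ?_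
      filter_upwards with x
      rw [norm_mul, norm_mul]
      calc _ ≤ 1 * ‖g x‖ * C := by
            gcongr
            · exact hinv _
            · exact hC x
        _ = _ := by ring
    have hB : Tendsto (fun k => ∫ x, (1 / (1 + (Fk k x / δ)^2)) * Gk k x * ψ x) atTop
        (𝓝 (∫ x, (1 / (1 + (F x / δ)^2)) * G x * ψ x)) := by
      have := hB1.add hB2
      rw [add_zero] at this
      refine this.congr fun k => ?_
      have h4 : Integrable (fun x => Gk k x - G x) := (hGi k).sub hG
      rw [← integral_add (hbint k _ hG) (hbint k _ h4)]
      refine integral_congr_ae (Eventually.of_forall fun x => ?_)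
      ring
    exact tendsto_nhds_unique hA ((hB.neg).congr fun k => (hk k).symm)
  -- limit δ → 0
  let G0 : EuclideanSpace ℝ (Fin n) → ℝ := fun x => (if F x = 0 then 1 else 0) * G x
  let δ : ℕ → ℝ := fun k => 1 / ((k : ℝ) + 1)
  have hδ : ∀ k, 0 < δ k := fun k => by positivity
  have hδ0 : Tendsto δ atTop (𝓝 0) := tendsto_one_div_add_atTop_nhds_zero_nat
  have hpt : ∀ x, Tendsto (fun k => (1 / (1 + (F x / δ k)^2)) * G x) atTop (𝓝 (G0 x)) := by
    intro x
    refine Tendsto.mul_const _ ?_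
    by_cases hx : F x = 0
    · simp [hx]
    · simp only [hx, if_false]
      have : Tendsto (fun k => (δ k)^2 / ((δ k)^2 + (F x)^2)) atTop (𝓝 (0^2 / (0^2 + (F x)^2))) :=
        (hδ0.pow 2).div ((hδ0.pow 2).add_const _) (by positivity)
      simp only [ne_eq, OfNat.ofNat_ne_zero, not_false_eq_true, zero_pow, zero_div] at this
      refine this.congr fun k => ?_
      have := (hδ k).ne'
      field_simp
  have hmeas : ∀ k, AEStronglyMeasurable (fun x => (1 / (1 + (F x / δ k)^2)) * G x) := by
    intro k
    have : AEMeasurable F := hF.aemeasurable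
    have h2 : AEMeasurable G := hG.aemeasurable
    exact (((((this.div_const _).pow_const 2).const_add 1).const_div 1).mul h2).aestronglyMeasurable
  have hinv : ∀ t : ℝ, |1 / (1 + t^2)| ≤ 1 := by
    intro t
    rw [abs_of_pos (by positivity), div_le_one (by positivity)]
    nlinarith [sq_nonneg t]
  have hG0m : AEStronglyMeasurable G0 :=
    aestronglyMeasurable_of_tendsto_ae atTop hmeas (Eventually.of_forall hpt)
  have hG0i : Integrable G0 := by
    refine hG.mono hG0m (Eventually.of_forall fun x => ?_)
    simp only [G0]
    split_ifs <;> simp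
  have hz : ∀ᵐ x, G0 x = 0 := by
    refine ae_eq_zero_of_integral_contDiff_smul_eq_zero hG0i.locallyIntegrable ?_
    intro ψ hψ hψc
    have hψ'c : Continuous (fun x => fderiv ℝ ψ x e) :=
      (hψ.continuous_fderiv (by simp)).clm_apply continuous_const
    have hψ's : HasCompactSupport (fun x => fderiv ℝ ψ x e) := hψc.fderiv_apply ℝ e
    have hψ'i : Integrable (fun x => fderiv ℝ ψ x e) := hψ'c.integrable_of_hasCompactSupport hψ's
    obtain ⟨C, hC⟩ := hψc.exists_bound_of_continuous hψ.continuous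
    have hC0 : 0 ≤ C := (norm_nonneg _).trans (hC 0)
    have hR : Tendsto (fun k => ∫ x, (1 / (1 + (F x / δ k)^2)) * G x * ψ x) atTop
        (𝓝 (∫ x, G0 x * ψ x)) := by
      refine tendsto_integral_of_dominated_convergence
        (fun x => 1 * |G x| * C) ?_ ((hG.abs.const_mul _).mul_const _) ?_ ?_
      · exact fun k => (hmeas k).mul hψ.continuous.aestronglyMeasurable
      · intro k
        filter_upwards with x
        rw [norm_mul, norm_mul]
        gcongr
        · exact hinv _
        · exact le_rfl
        · exact hC x
      · filter_upwards with x
        exact (hpt x).mul_const _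
    have hL : Tendsto (fun k => ∫ x, (δ k) * Real.arctan (F x / δ k) * fderiv ℝ ψ x e) atTop
        (𝓝 0) := by
      have := hδ0.mul_const (Real.pi / 2 * ∫ x, ‖fderiv ℝ ψ x e‖)
      rw [zero_mul] at this
      refine squeeze_zero_norm (fun k => ?_) this
      rw [← mul_assoc, ← integral_const_mul]
      refine norm_integral_le_of_norm_le (hψ'i.norm.const_mul _) ?_
      filter_upwards with x
      rw [norm_mul, norm_mul, Real.norm_eq_abs, abs_of_pos (hδ k), Real.norm_eq_abs]
      have := hδ k
      gcongr
      exact abs_le.2 ⟨(Real.neg_pi_div_two_lt_arctan _).le, (Real.arctan_lt_pi_div_two _).le⟩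
    have := tendsto_nhds_unique hL ((hR.neg).congr fun k => (hchain (δ k) (hδ k) ψ hψ hψc).symm)
    have h3 : ∫ x, G0 x * ψ x = 0 := by linarith
    rw [← h3]
    simp only [smul_eq_mul, mul_comm]
  filter_upwards [hz] with x hx h0
  simpa [G0, h0] using hx

lemma aux_int_smul {n : ℕ} {W : Type*} [NormedAddCommGroup W] [NormedSpace ℝ W]
    {Ω : Set (EuclideanSpace ℝ (Fin n))}
    {c : EuclideanSpace ℝ (Fin n) → ℝ} (hc : Continuous c) (hcs : HasCompactSupport c)
    (hcΩ : tsupport c ⊆ Ω) {g : EuclideanSpace ℝ (Fin n) → W} (hg : LocallyIntegrableOn g Ω) :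
    Integrable (fun x => c x • g x) := by
  have h1 : IntegrableOn g (tsupport c) := hg.integrableOn_compact_subset hcΩ hcs
  have h2 : IntegrableOn (fun x => c x • g x) (tsupport c) :=
    h1.continuousOn_smul hc.continuousOn hcs
  refine (integrableOn_iff_integrable_of_support_subset ?_).1 h2
  intro x hx
  refine subset_tsupport c ?_
  intro h0
  exact hx (by simp [h0])

lemma aux_int_smul' {n : ℕ} {W : Type*} [NormedAddCommGroup W] [NormedSpace ℝ W]
    {Ω : Set (EuclideanSpace ℝ (Fin n))}
    {c : EuclideanSpace ℝ (Fin n) → W} (hc : Continuous c) (hcs : HasCompactSupport c)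
    (hcΩ : tsupport c ⊆ Ω) {g : EuclideanSpace ℝ (Fin n) → ℝ} (hg : LocallyIntegrableOn g Ω) :
    Integrable (fun x => g x • c x) := by
  have h1 : IntegrableOn g (tsupport c) := hg.integrableOn_compact_subset hcΩ hcs
  have h2 : IntegrableOn (fun x => g x • c x) (tsupport c) :=
    h1.smul_continuousOn hc.continuousOn hcs
  refine (integrableOn_iff_integrable_of_support_subset ?_).1 h2
  intro x hx
  refine subset_tsupport c ?_
  intro h0
  exact hx (by simp [h0])

lemma aux_inner_gradient {n : ℕ} (ψ : EuclideanSpace ℝ (Fin n) → ℝ)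
    (x e : EuclideanSpace ℝ (Fin n)) : inner ℝ e (gradient ψ x) = fderiv ℝ ψ x e := by
  rw [real_inner_comm, ← toDual_gradient, InnerProductSpace.toDual_apply_apply]

lemma aux_comp {n : ℕ} {Ω : Set (EuclideanSpace ℝ (Fin n))}
    {f : EuclideanSpace ℝ (Fin n) → ℝ} {v : EuclideanSpace ℝ (Fin n) → EuclideanSpace ℝ (Fin n)}
    (h : HasWeakGradOn f v Ω) (e : EuclideanSpace ℝ (Fin n))
    (θ : EuclideanSpace ℝ (Fin n) → ℝ) (hθ : ContDiff ℝ (⊤ : ℕ∞) θ) (hθc : HasCompactSupport θ)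
    (hθΩ : tsupport θ ⊆ Ω) :
    ∫ x, f x * fderiv ℝ θ x e = - ∫ x, θ x * inner ℝ e (v x) := by
  obtain ⟨hf, hv, hw⟩ := h
  have h1 := hw θ hθ hθc hθΩ
  have hout : ∀ x, x ∉ Ω → θ x = 0 := fun x hx =>
    image_eq_zero_of_notMem_tsupport fun hh => hx (hθΩ hh)
  have hfd0 : ∀ x, x ∉ tsupport θ → fderiv ℝ θ x = 0 := fun x hx =>
    image_eq_zero_of_notMem_tsupport fun hh => hx (tsupport_fderiv_subset ℝ hh)
  have hg0 : ∀ x, x ∉ tsupport θ → gradient θ x = 0 := fun x hx => by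
    rw [gradient, hfd0 x hx, map_zero]
  rw [setIntegral_eq_integral_of_forall_compl_eq_zero
      (fun x hx => by rw [hg0 x (fun hh => hx (hθΩ hh)), smul_zero]),
    setIntegral_eq_integral_of_forall_compl_eq_zero
      (fun x hx => by rw [hout x hx, zero_smul])] at h1
  have hgc : Continuous (gradient θ) :=
    (InnerProductSpace.toDual ℝ _).symm.continuous.comp (hθ.continuous_fderiv (by simp))
  have hgs : tsupport (gradient θ) ⊆ tsupport θ :=
    closure_minimal (fun x hx => by
      by_contra hh
      exact hx (hg0 x hh)) (isClosed_tsupport θ)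
  have i1 := aux_int_smul' hgc (hθc.of_isClosed_subset (isClosed_tsupport _) hgs)
    (hgs.trans hθΩ) hf
  have i2 := aux_int_smul hθ.continuous hθc hθΩ hv
  have h2 := congrArg (fun w => inner ℝ e w) h1
  simp only [inner_neg_right] at h2
  rw [← integral_inner i1, ← integral_inner i2] at h2
  simpa [inner_smul_right, aux_inner_gradient] using h2

lemma aux_locality_cutoff {n : ℕ} {Ω : Set (EuclideanSpace ℝ (Fin n))}
    {f : EuclideanSpace ℝ (Fin n) → ℝ} {v : EuclideanSpace ℝ (Fin n) → EuclideanSpace ℝ (Fin n)}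
    (h : HasWeakGradOn f v Ω) (e : EuclideanSpace ℝ (Fin n))
    (χ : EuclideanSpace ℝ (Fin n) → ℝ) (hχ : ContDiff ℝ (⊤ : ℕ∞) χ) (hχc : HasCompactSupport χ)
    (hχΩ : tsupport χ ⊆ Ω) :
    ∀ᵐ x, f x = 0 → χ x * inner ℝ e (v x) = 0 := by
  have hχ'c : Continuous (fun x => fderiv ℝ χ x e) :=
    (hχ.continuous_fderiv (by simp)).clm_apply continuous_const
  have hχ'Ω : tsupport (fun x => fderiv ℝ χ x e) ⊆ Ω :=
    (tsupport_fderiv_apply_subset ℝ e).trans hχΩ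
  have hv := h.2.1
  have hvi : LocallyIntegrableOn (fun x => inner ℝ e (v x)) Ω := by
    intro x hx
    obtain ⟨s, hs, hi⟩ := hv x hx
    exact ⟨s, hs, Integrable.const_inner e hi⟩
  have iF : Integrable (fun x => χ x * f x) := aux_int_smul hχ.continuous hχc hχΩ h.1
  have iG1 : Integrable (fun x => χ x * inner ℝ e (v x)) :=
    aux_int_smul hχ.continuous hχc hχΩ hvi
  have iG2 : Integrable (fun x => fderiv ℝ χ x e * f x) :=
    aux_int_smul hχ'c (hχc.fderiv_apply ℝ e) hχ'Ω h.1
  have key := aux_global e (F := fun x => χ x * f x)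
    (G := fun x => χ x * inner ℝ e (v x) + fderiv ℝ χ x e * f x) iF (iG1.add iG2) (by
      intro ψ hψ hψc
      have h1 := aux_comp h e (fun x => χ x * ψ x) (hχ.mul hψ) hχc.mul_right
        ((tsupport_mul_subset_left).trans hχΩ)
      have hfd : ∀ x, fderiv ℝ (fun x => χ x * ψ x) x e
          = χ x * fderiv ℝ ψ x e + fderiv ℝ χ x e * ψ x := by
        intro x
        rw [fderiv_fun_mul (hχ.differentiable (by simp) x) (hψ.differentiable (by simp) x)]
        simp [mul_comm]
      simp only [hfd] at h1
      have hψ'c : Continuous (fun x => fderiv ℝ ψ x e) :=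
        (hψ.continuous_fderiv (by simp)).clm_apply continuous_const
      obtain ⟨C, hC⟩ := hψc.exists_bound_of_continuous hψ.continuous
      obtain ⟨C', hC'⟩ := (hψc.fderiv_apply ℝ e).exists_bound_of_continuous hψ'c
      have j1 : Integrable (fun x => (χ x * f x) * fderiv ℝ ψ x e) :=
        iF.mul_bdd hψ'c.aestronglyMeasurable (Filter.Eventually.of_forall hC')
      have j2 : Integrable (fun x => (fderiv ℝ χ x e * f x) * ψ x) :=
        iG2.mul_bdd hψ.continuous.aestronglyMeasurable (Filter.Eventually.of_forall hC)
      have j3 : Integrable (fun x => (χ x * inner ℝ e (v x)) * ψ x) :=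
        iG1.mul_bdd hψ.continuous.aestronglyMeasurable (Filter.Eventually.of_forall hC)
      have e1 : ∫ x, f x * (χ x * fderiv ℝ ψ x e + fderiv ℝ χ x e * ψ x)
          = (∫ x, (χ x * f x) * fderiv ℝ ψ x e) + ∫ x, (fderiv ℝ χ x e * f x) * ψ x := by
        rw [← integral_add j1 j2]
        congr 1; ext x; ring
      have e2 : ∫ x, ψ x * (χ x * inner ℝ e (v x) + fderiv ℝ χ x e * f x)
          = (∫ x, (χ x * inner ℝ e (v x)) * ψ x) + ∫ x, (fderiv ℝ χ x e * f x) * ψ x := by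
        rw [← integral_add j3 j2]
        congr 1; ext x; ring
      have e3 : ∫ x, χ x * ψ x * inner ℝ e (v x) = ∫ x, (χ x * inner ℝ e (v x)) * ψ x := by
        congr 1; ext x; ring
      rw [e1, e3] at h1
      rw [e2]
      linarith)
  filter_upwards [key] with x hx h0
  simpa [h0] using hx

/-- Locality: the weak gradient vanishes a.e. on the zero set. -/
lemma aux_locality {n : ℕ} {Ω : Set (EuclideanSpace ℝ (Fin n))} (hΩ : IsOpen Ω)
    {f : EuclideanSpace ℝ (Fin n) → ℝ} {v : EuclideanSpace ℝ (Fin n) → EuclideanSpace ℝ (Fin n)}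
    (h : HasWeakGradOn f v Ω) : ∀ᵐ x, x ∈ Ω → f x = 0 → v x = 0 := by
  have : volume {x | x ∈ Ω ∧ f x = 0 ∧ v x ≠ 0} = 0 := by
    refine measure_null_of_locally_null _ fun x hx => ?_
    obtain ⟨r, hr, hrΩ⟩ := Metric.isOpen_iff.1 hΩ x hx.1
    let χ : ContDiffBump x := ⟨r / 4, r / 2, by positivity, by linarith⟩
    have hχΩ : tsupport χ ⊆ Ω := by
      rw [χ.tsupport_eq]
      exact (Metric.closedBall_subset_ball (by change r / 2 < r; linarith)).trans hrΩ
    refine ⟨{x | x ∈ Ω ∧ f x = 0 ∧ v x ≠ 0} ∩ Metric.closedBall x (r / 4),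
      Filter.inter_mem self_mem_nhdsWithin (mem_nhdsWithin_of_mem_nhds
        (Metric.closedBall_mem_nhds x (by positivity))), ?_⟩
    have hall : ∀ᵐ y, ∀ i : Fin n, f y = 0 →
        χ y * inner ℝ (EuclideanSpace.single i (1 : ℝ)) (v y) = 0 :=
      ae_all_iff.2 fun i => aux_locality_cutoff h _ χ χ.contDiff χ.hasCompactSupport hχΩ
    refine measure_mono_null ?_ hall
    rintro y ⟨⟨_, hfy, hvy⟩, hyb⟩ hcon
    apply hvy
    ext i
    have := hcon i hfy
    rw [χ.one_of_mem_closedBall hyb] at this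
    simpa [EuclideanSpace.inner_single_left] using this
  filter_upwards [compl_mem_ae_iff.2 this] with x hx hxΩ hfx
  by_contra hv
  exact hx ⟨hxΩ, hfx, hv⟩

lemma aux_neg {n : ℕ} {Ω : Set (EuclideanSpace ℝ (Fin n))}
    {f : EuclideanSpace ℝ (Fin n) → ℝ} {v : EuclideanSpace ℝ (Fin n) → EuclideanSpace ℝ (Fin n)}
    (c : ℝ) (h : HasWeakGradOn f v Ω) : HasWeakGradOn (fun x => c * f x) (fun x => c • v x) Ω := by
  refine ⟨h.1.smul c, h.2.1.smul c, fun ψ h1 h2 h3 => ?_⟩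
  have := h.2.2 ψ h1 h2 h3
  simp only [mul_smul, smul_comm _ c]
  rw [integral_smul, integral_smul, this, smul_neg]

lemma aux_gradc {n : ℕ} {ψ : EuclideanSpace ℝ (Fin n) → ℝ} (hψ : ContDiff ℝ (⊤ : ℕ∞) ψ)
    (hψc : HasCompactSupport ψ) : Continuous (gradient ψ) ∧ tsupport (gradient ψ) ⊆ tsupport ψ
    ∧ HasCompactSupport (gradient ψ) := by
  have hg : tsupport (gradient ψ) ⊆ tsupport ψ :=
    closure_minimal (fun x hx => by
      by_contra hh
      refine hx ?_
      have : fderiv ℝ ψ x = 0 :=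
        image_eq_zero_of_notMem_tsupport fun h => hh (tsupport_fderiv_subset ℝ h)
      rw [gradient, this, map_zero]) (isClosed_tsupport ψ)
  exact ⟨(InnerProductSpace.toDual ℝ _).symm.continuous.comp (hψ.continuous_fderiv (by simp)),
    hg, hψc.of_isClosed_subset (isClosed_tsupport _) hg⟩

lemma aux_sub {n : ℕ} {Ω : Set (EuclideanSpace ℝ (Fin n))}
    {f g : EuclideanSpace ℝ (Fin n) → ℝ} {v w : EuclideanSpace ℝ (Fin n) → EuclideanSpace ℝ (Fin n)}
    (h : HasWeakGradOn f v Ω) (h' : HasWeakGradOn g w Ω) :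
    HasWeakGradOn (fun x => f x - g x) (fun x => v x - w x) Ω := by
  refine ⟨h.1.sub h'.1, h.2.1.sub h'.2.1, fun ψ h1 h2 h3 => ?_⟩
  have a := h.2.2 ψ h1 h2 h3
  have b := h'.2.2 ψ h1 h2 h3
  obtain ⟨c1, c2, c3⟩ := aux_gradc h1 h2
  simp only [sub_smul, smul_sub]
  rw [integral_sub (aux_int_smul' c1 c3 (c2.trans h3) h.1).integrableOn
      (aux_int_smul' c1 c3 (c2.trans h3) h'.1).integrableOn,
    integral_sub (aux_int_smul h1.continuous h2 h3 h.2.1).integrableOn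
      (aux_int_smul h1.continuous h2 h3 h'.2.1).integrableOn, a, b]
  abel

lemma aux_const {n : ℕ} {Ω : Set (EuclideanSpace ℝ (Fin n))} (c : ℝ) :
    HasWeakGradOn (fun _ => c) (fun _ => (0 : EuclideanSpace ℝ (Fin n))) Ω := by
  refine ⟨(locallyIntegrable_const c).locallyIntegrableOn _,
    (locallyIntegrable_const _).locallyIntegrableOn _, fun ψ h1 h2 h3 => ?_⟩
  obtain ⟨c1, c2, c3⟩ := aux_gradc h1 h2
  have hi : Integrable (gradient ψ) := c1.integrable_of_hasCompactSupport c3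
  rw [setIntegral_eq_integral_of_forall_compl_eq_zero
      (fun x hx => by rw [image_eq_zero_of_notMem_tsupport (fun hh => hx (h3 (c2 hh))), smul_zero])]
  simp only [smul_zero, integral_zero, neg_zero]
  rw [integral_smul]
  have : ∫ x, gradient ψ x = 0 := by
    ext i
    have h4 : ∫ x, inner ℝ (EuclideanSpace.single i (1 : ℝ)) (gradient ψ x) = 0 := by
      simp only [aux_inner_gradient]
      have := integral_mul_fderiv_eq_neg_fderiv_mul_of_integrable (μ := volume)
        (f := fun _ : EuclideanSpace ℝ (Fin n) => (1 : ℝ)) (g := ψ)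
        (v := EuclideanSpace.single i (1 : ℝ)) (by simp) (by
          simp only [one_mul]
          exact ((h1.continuous_fderiv (by simp)).clm_apply
            continuous_const).integrable_of_hasCompactSupport (h2.fderiv_apply ℝ _))
        (by simpa using h1.continuous.integrable_of_hasCompactSupport h2)
        (by fun_prop) (fun x _ => h1.differentiable (by simp) x)
      simpa using this
    rw [integral_inner hi] at h4
    simpa [EuclideanSpace.inner_single_left] using h4
  rw [this, smul_zero]

/-- If `g = ± f + c` pointwise with countably many constants on a set, gradients have equal norm. -/
lemma aux_norm_eq {n : ℕ} {Ω : Set (EuclideanSpace ℝ (Fin n))} (hΩ : IsOpen Ω)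
    {f g : EuclideanSpace ℝ (Fin n) → ℝ} {v w : EuclideanSpace ℝ (Fin n) → EuclideanSpace ℝ (Fin n)}
    (h : HasWeakGradOn f v Ω) (h' : HasWeakGradOn g w Ω)
    {ι : Type*} [Countable ι] (c : ι → ℝ) :
    ∀ᵐ x, x ∈ Ω → (∃ i, g x = f x - c i ∨ g x = c i - f x) → ‖w x‖ = ‖v x‖ := by
  have h1 : ∀ᵐ x, ∀ i, x ∈ Ω → f x - g x - c i = 0 → v x - w x - 0 = 0 :=
    ae_all_iff.2 fun i => aux_locality hΩ (aux_sub (aux_sub h h') (aux_const (c i)))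
  have h2 : ∀ᵐ x, ∀ i, x ∈ Ω → (-1) * f x - g x - (- c i) = 0 → (-1 : ℝ) • v x - w x - 0 = 0 :=
    ae_all_iff.2 fun i => aux_locality hΩ (aux_sub (aux_sub (aux_neg (-1) h) h') (aux_const (- c i)))
  filter_upwards [h1, h2] with x h1 h2 hx hi
  obtain ⟨i, hi | hi⟩ := hi
  · have := h1 i hx (by rw [hi]; ring)
    rw [sub_zero, sub_eq_zero] at this
    rw [this]
  · have := h2 i hx (by rw [hi]; ring)
    rw [sub_zero, sub_eq_zero] at this
    rw [← this]; simp

def zig (ε t : ℝ) : ℝ := ε * |t / ε - round (t / ε)|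

lemma zig_le {ε : ℝ} (hε : 0 < ε) (t : ℝ) : zig ε t ≤ ε := by
  have := abs_sub_round (t / ε)
  unfold zig
  nlinarith

lemma zig_nonneg {ε : ℝ} (hε : 0 < ε) (t : ℝ) : 0 ≤ zig ε t :=
  mul_nonneg hε.le (abs_nonneg _)

lemma zig_eq {ε : ℝ} (hε : 0 < ε) (t : ℝ) :
    ∃ m : ℤ, zig ε t = t - ε * m ∨ zig ε t = ε * m - t := by
  refine ⟨round (t / ε), ?_⟩
  unfold zig
  rcases abs_choice (t / ε - round (t / ε)) with h | h
  · left; rw [h]; field_simp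
  · right; rw [h]; field_simp; ring

lemma zig_lip {ε : ℝ} (hε : 0 < ε) (s t : ℝ) : zig ε s ≤ zig ε t + |s - t| := by
  have h1 := round_le (s / ε) (round (t / ε))
  have h2 := abs_sub_le (s / ε) (t / ε) (round (t / ε))
  have h3 : ε * |s / ε - t / ε| = |s - t| := by
    rw [← sub_div, abs_div, abs_of_pos hε]; field_simp
  unfold zig
  rw [← h3, ← mul_add]
  exact mul_le_mul_of_nonneg_left (by linarith) hε.le

lemma lipConst_le {Y : Type*} [MetricSpace Y] {u : Y → ℝ} (hu : LipschitzWith 1 u) :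
    0 ≤ lipConst u ∧ lipConst u ≤ 1 := by
  refine ⟨Real.sInf_nonneg fun x hx => hx.1, csInf_le ⟨0, fun x hx => hx.1⟩ ⟨zero_le_one, ?_⟩⟩
  intro a b
  simpa [Real.dist_eq] using hu.dist_le_mul a b

lemma isLipschitz_of {Y : Type*} [MetricSpace Y] {u : Y → ℝ} (hu : LipschitzWith 1 u) :
    IsLipschitz u :=
  ⟨1, zero_le_one, fun a b => by simpa [Real.dist_eq] using hu.dist_le_mul a b⟩

lemma lipConst_spec {Y : Type*} [MetricSpace Y] {u : Y → ℝ} (hu : IsLipschitz u) :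
    0 ≤ lipConst u ∧ ∀ a b, |u a - u b| ≤ lipConst u * dist a b := by
  refine ⟨Real.sInf_nonneg fun x hx => hx.1, fun a b => ?_⟩
  rcases eq_or_ne a b with rfl | hab
  · simp
  have hd : 0 < dist a b := dist_pos.2 hab
  rw [← div_le_iff₀ hd]
  obtain ⟨L, hL⟩ := hu
  refine le_csInf ⟨L, hL⟩ fun M hM => ?_
  rw [div_le_iff₀ hd]
  exact hM.2 a b

lemma Phi_bdd {n : ℕ} {Y : Type*} [MetricSpace Y]
    {Ω : Set (EuclideanSpace ℝ (Fin n))} (hΩo : IsOpen Ω)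
    {q K : ℝ} (hq : 1 ≤ q) (hK : 0 ≤ K)
    {φ : EuclideanSpace ℝ (Fin n) → Y}
    (hbd : ∀ u : Y → ℝ, IsLipschitz u →
      ∃ v, HasWeakGradOn (u ∘ φ) v Ω ∧ IntegrableOn (fun x => ‖v x‖ ^ q) Ω volume ∧
        (∫ x in Ω, ‖v x‖ ^ q) ^ (1/q) ≤ K * lipConst u)
    (V : Set Y) :
    BddAbove {I : ℝ | ∃ (u : Y → ℝ) (v : EuclideanSpace ℝ (Fin n) → EuclideanSpace ℝ (Fin n)),
      LipschitzWith 1 u ∧ 0 < eSetDist (tsupport u) Vᶜ ∧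
      HasWeakGradOn (u ∘ φ) v Ω ∧ IntegrableOn (fun x => ‖v x‖ ^ q) Ω volume ∧
      I = ∫ x in Ω, ‖v x‖ ^ q} := by
  refine ⟨K ^ q, ?_⟩
  rintro I ⟨u, v, hu, -, hv, hvi, rfl⟩
  obtain ⟨v', hv', hvi', hle⟩ := hbd u (isLipschitz_of hu)
  have hae := aux_locality hΩo (aux_sub hv hv')
  have heq : ∫ x in Ω, ‖v x‖ ^ q = ∫ x in Ω, ‖v' x‖ ^ q := by
    refine setIntegral_congr_ae hΩo.measurableSet ?_
    filter_upwards [hae] with x hx hxΩ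
    rw [sub_eq_zero.1 (hx hxΩ (by simp))]
  rw [heq]
  obtain ⟨hl0, hl1⟩ := lipConst_le hu
  have h0 : 0 ≤ ∫ x in Ω, ‖v' x‖ ^ q := integral_nonneg fun x => by positivity
  have h1 : (∫ x in Ω, ‖v' x‖ ^ q) ^ (1/q) ≤ K := hle.trans (by nlinarith)
  have h2 := Real.rpow_le_rpow (by positivity) h1 (by linarith : 0 ≤ q)
  rwa [← Real.rpow_mul h0, one_div_mul_cancel (by linarith), Real.rpow_one] at h2

lemma claim {n : ℕ} {Y : Type*} [MetricSpace Y]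
    {Ω : Set (EuclideanSpace ℝ (Fin n))} (hΩo : IsOpen Ω)
    {q K : ℝ} (hq : 1 ≤ q) (hK : 0 ≤ K)
    {φ : EuclideanSpace ℝ (Fin n) → Y}
    (hbd : ∀ u : Y → ℝ, IsLipschitz u →
      ∃ v, HasWeakGradOn (u ∘ φ) v Ω ∧ IntegrableOn (fun x => ‖v x‖ ^ q) Ω volume ∧
        (∫ x in Ω, ‖v x‖ ^ q) ^ (1/q) ≤ K * lipConst u)
    (V : Set Y) {u : Y → ℝ}
    {v : EuclideanSpace ℝ (Fin n) → EuclideanSpace ℝ (Fin n)} (hv : HasWeakGradOn (u ∘ φ) v Ω)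
    {ε : ℝ} (hε : 0 < ε) {w : Y → ℝ} (hw : LipschitzWith 1 w)
    (hwV : 0 < eSetDist (tsupport w) Vᶜ) (A : Set Y)
    (hA : NullMeasurableSet (φ ⁻¹' A) (volume.restrict Ω))
    (hwA : ∀ y ∈ A, w y = zig ε (u y)) :
    ∫ x in φ ⁻¹' A, ‖v x‖ ^ q ∂(volume.restrict Ω) ≤ Phi q φ Ω V := by
  obtain ⟨g, hg, hgi, -⟩ := hbd w (isLipschitz_of hw)
  have h1 : ∫ x in Ω, ‖g x‖ ^ q ≤ Phi q φ Ω V :=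
    le_csSup (Phi_bdd hΩo hq hK hbd V) ⟨w, g, hw, hwV, hg, hgi, rfl⟩
  refine le_trans ?_ h1
  have hae := aux_norm_eq hΩo hv hg (fun m : ℤ => ε * m)
  have h2 : ∫ x in φ ⁻¹' A, ‖v x‖ ^ q ∂(volume.restrict Ω)
      = ∫ x in φ ⁻¹' A, ‖g x‖ ^ q ∂(volume.restrict Ω) := by
    refine integral_congr_ae ?_
    refine (ae_restrict_iff'₀ hA).2 ?_
    refine (ae_restrict_iff' hΩo.measurableSet).2 ?_
    filter_upwards [hae] with x hx hxΩ hxA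
    have := hx hxΩ (by
      obtain ⟨m, hm⟩ := zig_eq hε (u (φ x))
      refine ⟨m, ?_⟩
      simpa [hwA _ hxA] using hm)
    simp only [this]
  rw [h2]
  exact setIntegral_le_integral hgi (Filter.Eventually.of_forall fun x => by positivity)

lemma normalized {n : ℕ} {Y : Type*} [MetricSpace Y]
    {Ω : Set (EuclideanSpace ℝ (Fin n))} (hΩo : IsOpen Ω)
    {q K : ℝ} (hq : 1 ≤ q) (hK : 0 ≤ K)
    {φ : EuclideanSpace ℝ (Fin n) → Y}
    (hbd : ∀ u : Y → ℝ, IsLipschitz u →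
      ∃ v, HasWeakGradOn (u ∘ φ) v Ω ∧ IntegrableOn (fun x => ‖v x‖ ^ q) Ω volume ∧
        (∫ x in Ω, ‖v x‖ ^ q) ^ (1/q) ≤ K * lipConst u)
    (V : Set Y) (hV : IsOpen V) {u : Y → ℝ} (hu : LipschitzWith 1 u)
    {v : EuclideanSpace ℝ (Fin n) → EuclideanSpace ℝ (Fin n)} (hv : HasWeakGradOn (u ∘ φ) v Ω)
    (hvi : IntegrableOn (fun x => ‖v x‖ ^ q) Ω volume) :
    ∫ x in Ω ∩ φ ⁻¹' V, ‖v x‖ ^ q ≤ Phi q φ Ω V := by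
  rw [inter_comm, ← Measure.restrict_restrict' hΩo.measurableSet]
  have hulip : ∀ a b, |u a - u b| ≤ dist a b := fun a b => by
    simpa [Real.dist_eq] using hu.dist_le_mul a b
  by_cases hVu : V = univ
  · subst hVu
    refine claim hΩo hq hK hbd univ hv one_pos (w := fun y => zig 1 (u y)) ?_ ?_ univ ?_ ?_
    · refine LipschitzWith.of_le_add fun a b => ?_
      have := zig_lip one_pos (u a) (u b)
      have := hulip a b
      linarith
    · simp [eSetDist]
    · simp
    · simp
  have hne : (Vᶜ).Nonempty := nonempty_compl.2 hVu
  let d : Y → ℝ := fun y => Metric.infDist y Vᶜ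
  have hd : ∀ a b, d a ≤ d b + dist a b := fun a b => Metric.infDist_le_infDist_add_dist
  have hdlip : LipschitzWith 1 d := LipschitzWith.of_le_add hd
  have hdm : AEMeasurable (d ∘ φ) (volume.restrict Ω) := by
    obtain ⟨g, hg, -⟩ := hbd d (isLipschitz_of hdlip)
    exact hg.1.aestronglyMeasurable.aemeasurable
  let ε : ℕ → ℝ := fun k => 1 / ((k : ℝ) + 1)
  have hε : ∀ k, 0 < ε k := fun k => by positivity
  let A : ℕ → Set Y := fun k => {y | 2 * ε k ≤ d y}
  have hAm : ∀ k, NullMeasurableSet (φ ⁻¹' (A k)) (volume.restrict Ω) := fun k =>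
    hdm.nullMeasurableSet_preimage (measurableSet_Ici (a := 2 * ε k))
  have hU : φ ⁻¹' V = ⋃ k, φ ⁻¹' (A k) := by
    ext x
    simp only [mem_preimage, mem_iUnion, A, mem_ofPred_eq]
    constructor
    · intro hx
      have : 0 < d (φ x) := (hV.isClosed_compl.notMem_iff_infDist_pos hne).1 (by simpa using hx)
      obtain ⟨k, hk⟩ := exists_nat_one_div_lt (half_pos this)
      exact ⟨k, by simp only [ε]; linarith⟩
    · rintro ⟨k, hk⟩
      by_contra hx
      have : d (φ x) = 0 := Metric.infDist_zero_of_mem hx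
      linarith [hε k]
  have hmono : Monotone fun k => φ ⁻¹' (A k) := by
    intro k l hkl x hx
    have : ε l ≤ ε k := one_div_le_one_div_of_le (by positivity) (by simpa using hkl)
    simp only [mem_preimage, A, mem_ofPred_eq] at hx ⊢
    linarith
  have hlim := tendsto_setIntegral_of_monotone₀ hAm hmono (μ := volume.restrict Ω)
    (f := fun x => ‖v x‖ ^ q) (Integrable.integrableOn hvi)
  rw [← hU] at hlim
  refine le_of_tendsto' hlim fun k => ?_
  refine claim hΩo hq hK hbd V hv (hε k)
    (w := fun y => min (zig (ε k) (u y)) (max (d y - ε k) 0)) ?_ ?_ (A k) (hAm k) ?_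
  · refine LipschitzWith.of_le_add fun a b => ?_
    have h1 := zig_lip (hε k) (u a) (u b)
    have h2 := hulip a b
    have h3 := hd a b
    have h4 : (0 : ℝ) ≤ dist a b := dist_nonneg
    rw [← min_add_add_right, ← max_add_add_right]
    refine min_le_min (by linarith) (max_le_max (by linarith) (by linarith))
  · have hsub : tsupport (fun y => min (zig (ε k) (u y)) (max (d y - ε k) 0)) ⊆ {y | ε k ≤ d y} := by
      refine closure_minimal ?_ (isClosed_le continuous_const hdlip.continuous)
      intro y hy
      by_contra hlt
      simp only [mem_ofPred_eq, not_le] at hlt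
      refine hy ?_
      have : max (d y - ε k) 0 = 0 := max_eq_right (by linarith)
      simp only [this]
      exact min_eq_right (zig_nonneg (hε k) _)
    refine lt_of_lt_of_le (ENNReal.ofReal_pos.2 (hε k)) ?_
    refine le_iInf₂ fun y hy => le_iInf₂ fun z hz => ?_
    rw [edist_dist]
    exact ENNReal.ofReal_le_ofReal ((hsub hy).trans (Metric.infDist_le_dist_of_mem hz))
  · intro y hy
    have hy' : 2 * ε k ≤ d y := hy
    refine min_eq_left (le_max_of_le_left ?_)
    linarith [zig_le (hε k) (u y)]


/-- If `φ` induces a bounded composition operator `Lip(Y) → L¹_q(Ω)`, then for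
every open `V ⊆ Y` and every Lipschitz `u`, `∫_{φ⁻¹(V)} ‖∇(u∘φ)‖^q ≤ Lip(u)^q · Φ(V)`. -/
theorem integral_on_preimage_le_lipConst_mul_Phi
    {n : ℕ} (hn : 0 < n) {Y : Type*} [MetricSpace Y]
    (Ω : Set (EuclideanSpace ℝ (Fin n))) (hΩo : IsOpen Ω) (hΩc : IsConnected Ω)
    (q K : ℝ) (hq : 1 ≤ q) (hK : 0 ≤ K)
    (φ : EuclideanSpace ℝ (Fin n) → Y)
    (hbd : ∀ u : Y → ℝ, IsLipschitz u →
      ∃ v, HasWeakGradOn (u ∘ φ) v Ω ∧ IntegrableOn (fun x => ‖v x‖ ^ q) Ω volume ∧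
        (∫ x in Ω, ‖v x‖ ^ q) ^ (1/q) ≤ K * lipConst u) :
    ∀ V : Set Y, IsOpen V → ∀ u : Y → ℝ, IsLipschitz u →
      ∀ v : EuclideanSpace ℝ (Fin n) → EuclideanSpace ℝ (Fin n),
        HasWeakGradOn (u ∘ φ) v Ω → IntegrableOn (fun x => ‖v x‖ ^ q) Ω volume →
        ∫ x in Ω ∩ φ ⁻¹' V, ‖v x‖ ^ q ≤ lipConst u ^ q * Phi q φ Ω V := by
  intro V hV u hu v hv hvi
  obtain ⟨hL0, hL⟩ := lipConst_spec hu
  have hq0 : q ≠ 0 := by linarith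
  rcases hL0.eq_or_lt with h0 | hpos
  · rw [← h0, Real.zero_rpow hq0, zero_mul]
    have hae := aux_locality hΩo (aux_sub hv (aux_const (u (φ 0))))
    have hz : ∀ᵐ x ∂(volume.restrict Ω), ‖v x‖ ^ q = 0 := by
      refine (ae_restrict_iff' hΩo.measurableSet).2 ?_
      filter_upwards [hae] with x hx hxΩ
      have h1 := hL (φ x) (φ 0)
      rw [← h0, zero_mul] at h1
      have h2 := hx hxΩ (abs_eq_zero.1 (le_antisymm h1 (abs_nonneg _)))
      rw [sub_zero] at h2
      simp [h2, Real.zero_rpow hq0]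
    have hz' : ∀ᵐ x ∂(volume.restrict (Ω ∩ φ ⁻¹' V)), ‖v x‖ ^ q = 0 :=
      ae_mono (Measure.restrict_mono inter_subset_left le_rfl) hz
    exact (integral_eq_zero_of_ae hz').le
  · set L := lipConst u with hLdef
    have hlip : LipschitzWith 1 (fun y => L⁻¹ * u y) := by
      refine LipschitzWith.of_dist_le_mul fun a b => ?_
      rw [Real.dist_eq, ← mul_sub, abs_mul, abs_of_pos (inv_pos.2 hpos), NNReal.coe_one, one_mul,
        inv_mul_le_iff₀ hpos]
      exact hL a b
    have hnorm : ∀ x, ‖L⁻¹ • v x‖ ^ q = (L⁻¹) ^ q * ‖v x‖ ^ q := fun x => by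
      rw [norm_smul, Real.norm_of_nonneg (inv_pos.2 hpos).le,
        Real.mul_rpow (inv_pos.2 hpos).le (norm_nonneg _)]
    have hmain := normalized hΩo hq hK hbd V hV hlip (v := fun x => L⁻¹ • v x)
      (aux_neg L⁻¹ hv) (by
        simp only [hnorm]
        exact Integrable.const_mul hvi _)
    simp only [hnorm] at hmain
    rw [integral_const_mul, Real.inv_rpow hpos.le, inv_mul_le_iff₀ (Real.rpow_pos_of_pos hpos q)]
      at hmain
    exact hmain
end
end
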